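/- arXiv:2109.10225 — 4 statements merged into one kernel-verified Lean document; each statement's English description precedes it below -/
import Mathlib

section
/- Let N be a nonzero rational number and write N = n·m² where n is a square-free integer and m is a rational number. Then N is represented over the rationals by the form ax² + by² + cz² if and only if all of the following hold: (1) if a, b, c are all positive then N > 0, and if a, b, c are all negative then N < 0; (2) if a, b, c are all odd and a ≡ b ≡ c (mod 4), then n ≢ -abc (mod 8); (3) if one of a, b, c is even (call it e, with the two odd coefficients f, g) and f + g ≡ e (mod 8) or f + g ≡ 2e (mod 8), then n ≢ -abc (mod 16); (4) for every odd prime p dividing both n and a, either the Legendre symbol of -bc modulo p equals 1 or the Legendre symbol of (n/p)·(a/p) modulo p equals 1 (where n/p and a/p denote integer quotients), and the analogous condition holds with a replaced by b (with -ac) and by c (with -ab). -/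
namespace QF

def vv (p : ℕ) (x : ℤ) : ZMod 2 := (padicValInt p x : ZMod 2)
def uu (p : ℕ) (x : ℤ) : ℤ := x / (p : ℤ) ^ padicValInt p x
def sg (j : ℤ) : ZMod 2 := if j = -1 then 1 else 0
def ss (p : ℕ) (x : ℤ) : ZMod 2 := sg (jacobiSym (uu p x) p)
def ep (x : ℤ) : ZMod 2 := sg (ZMod.χ₄ (uu 2 x : ℤ))
def om (x : ℤ) : ZMod 2 := sg (ZMod.χ₈ (uu 2 x : ℤ))
def ng (x : ℤ) : ZMod 2 := if x < 0 then 1 else 0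
def hh (p : ℕ) (x y : ℤ) : ZMod 2 :=
  ss p (-1) * vv p x * vv p y + ss p x * vv p y + ss p y * vv p x
def h2 (x y : ℤ) : ZMod 2 := ep x * ep y + om x * vv 2 y + om y * vv 2 x
def hi (x y : ℤ) : ZMod 2 := ng x * ng y

lemma two0 : (2 : ZMod 2) = 0 := by decide

lemma uu_spec {p : ℕ} (hp : p.Prime) {x : ℤ} (hx : x ≠ 0) :
    x = (p : ℤ) ^ padicValInt p x * uu p x ∧ ¬ (p : ℤ) ∣ uu p x := by
  have := Fact.mk hp
  have h1 : x = (p : ℤ) ^ padicValInt p x * uu p x :=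
    (Int.mul_ediv_cancel' (padicValInt_dvd x)).symm
  refine ⟨h1, fun hd => ?_⟩
  have : (p : ℤ) ^ (padicValInt p x + 1) ∣ x := by
    obtain ⟨k, hk⟩ := hd
    refine ⟨k, ?_⟩
    rw [pow_succ, mul_assoc, ← hk]; exact h1
  rcases (padicValInt_dvd_iff _ _).1 this with h | h
  · exact hx h
  · omega

lemma uu_uniq {p : ℕ} (hp : p.Prime) {u : ℤ} (k : ℕ) (hu : ¬ (p : ℤ) ∣ u) :
    padicValInt p ((p : ℤ) ^ k * u) = k ∧ uu p ((p : ℤ) ^ k * u) = u := by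
  have := Fact.mk hp
  have hp0 : (p : ℤ) ≠ 0 := by exact_mod_cast hp.ne_zero
  have hu0 : u ≠ 0 := by rintro rfl; exact hu (dvd_zero _)
  have h1 : padicValInt p ((p : ℤ) ^ k * u) = k := by
    have a1 : k ≤ padicValInt p ((p : ℤ) ^ k * u) := by
      rcases (padicValInt_dvd_iff k ((p : ℤ) ^ k * u)).1 (Dvd.intro _ rfl) with h | h
      · exact absurd h (mul_ne_zero (pow_ne_zero _ hp0) hu0)
      · exact h
    by_contra hne
    have : k + 1 ≤ padicValInt p ((p : ℤ) ^ k * u) := by omega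
    have h3 := (padicValInt_dvd_iff (k + 1) ((p : ℤ) ^ k * u)).2 (Or.inr this)
    rw [pow_succ] at h3
    exact hu (Int.dvd_of_mul_dvd_mul_left (pow_ne_zero _ hp0) h3)
  refine ⟨h1, ?_⟩
  unfold uu
  rw [h1]
  exact Int.mul_ediv_cancel_left _ (pow_ne_zero _ hp0)

lemma vu_mul {p : ℕ} (hp : p.Prime) {x y : ℤ} (hx : x ≠ 0) (hy : y ≠ 0) :
    padicValInt p (x * y) = padicValInt p x + padicValInt p y ∧ uu p (x * y) = uu p x * uu p y := by
  obtain ⟨a1, a2⟩ := uu_spec hp hx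
  obtain ⟨b1, b2⟩ := uu_spec hp hy
  have hn : ¬ (p : ℤ) ∣ uu p x * uu p y := fun h =>
    ((Nat.prime_iff_prime_int.1 hp).dvd_or_dvd h).elim a2 b2
  have := uu_uniq hp (padicValInt p x + padicValInt p y) hn
  have e : (p : ℤ) ^ (padicValInt p x + padicValInt p y) * (uu p x * uu p y) = x * y := by
    conv_rhs => rw [a1, b1]
    ring
  rwa [e] at this

lemma vu_unit {p : ℕ} (hp : p.Prime) {x : ℤ} (hx : ¬ (p : ℤ) ∣ x) :
    padicValInt p x = 0 ∧ uu p x = x := by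
  have := uu_uniq hp 0 hx
  simpa using this

lemma sg_mul {j k : ℤ} (hj : j = 1 ∨ j = -1) (hk : k = 1 ∨ k = -1) :
    sg (j * k) = sg j + sg k := by
  rcases hj with rfl | rfl <;> rcases hk with rfl | rfl <;> decide

lemma sg_inj {j : ℤ} (hj : j = 1 ∨ j = -1) : sg j = 0 ↔ j = 1 := by
  rcases hj with rfl | rfl <;> decide

lemma vv_mul {p : ℕ} (hp : p.Prime) {x y : ℤ} (hx : x ≠ 0) (hy : y ≠ 0) :
    vv p (x * y) = vv p x + vv p y := by
  unfold vv; rw [(vu_mul hp hx hy).1]; push_cast; rfl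

lemma jac_pm {p : ℕ} (hp : p.Prime) {u : ℤ} (hu : ¬ (p : ℤ) ∣ u) :
    jacobiSym u p = 1 ∨ jacobiSym u p = -1 := by
  apply jacobiSym.eq_one_or_neg_one
  have := (Nat.prime_iff_prime_int.1 hp).coprime_iff_not_dvd.2 hu
  exact Int.isCoprime_iff_gcd_eq_one.1 this.symm

lemma ss_mul {p : ℕ} (hp : p.Prime) {x y : ℤ} (hx : x ≠ 0) (hy : y ≠ 0) :
    ss p (x * y) = ss p x + ss p y := by
  unfold ss
  rw [(vu_mul hp hx hy).2, jacobiSym.mul_left]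
  exact sg_mul (jac_pm hp (uu_spec hp hx).2) (jac_pm hp (uu_spec hp hy).2)

lemma chi4_pm {u : ℤ} (hu : ¬ (2 : ℤ) ∣ u) : ZMod.χ₄ (u : ℤ) = 1 ∨ ZMod.χ₄ (u : ℤ) = -1 := by
  rw [ZMod.χ₄_int_eq_if_mod_four]
  have : u % 2 ≠ 0 := by omega
  simp only [this, if_false]
  split_ifs <;> simp

lemma chi8_pm {u : ℤ} (hu : ¬ (2 : ℤ) ∣ u) : ZMod.χ₈ (u : ℤ) = 1 ∨ ZMod.χ₈ (u : ℤ) = -1 := by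
  rw [ZMod.χ₈_int_eq_if_mod_eight]
  have : u % 2 ≠ 0 := by omega
  simp only [this, if_false]
  split_ifs <;> simp

lemma ep_mul {x y : ℤ} (hx : x ≠ 0) (hy : y ≠ 0) : ep (x * y) = ep x + ep y := by
  unfold ep
  rw [(vu_mul Nat.prime_two hx hy).2]
  push_cast
  rw [map_mul]
  exact sg_mul (chi4_pm (uu_spec Nat.prime_two hx).2) (chi4_pm (uu_spec Nat.prime_two hy).2)

lemma om_mul {x y : ℤ} (hx : x ≠ 0) (hy : y ≠ 0) : om (x * y) = om x + om y := by
  unfold om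
  rw [(vu_mul Nat.prime_two hx hy).2]
  push_cast
  rw [map_mul]
  exact sg_mul (chi8_pm (uu_spec Nat.prime_two hx).2) (chi8_pm (uu_spec Nat.prime_two hy).2)

lemma ng_mul {x y : ℤ} (hx : x ≠ 0) (hy : y ≠ 0) : ng (x * y) = ng x + ng y := by
  unfold ng
  rcases lt_or_gt_of_ne hx with h1 | h1 <;> rcases lt_or_gt_of_ne hy with h2 | h2
  · rw [if_pos h1, if_pos h2, if_neg (mul_pos_of_neg_of_neg h1 h2).le.not_gt]; decide
  · rw [if_pos h1, if_neg h2.le.not_gt, if_pos (mul_neg_of_neg_of_pos h1 h2)]; decide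
  · rw [if_neg h1.le.not_gt, if_pos h2, if_pos (mul_neg_of_pos_of_neg h1 h2)]; decide
  · rw [if_neg h1.le.not_gt, if_neg h2.le.not_gt, if_neg (mul_pos h1 h2).le.not_gt]; decide

lemma hh_mul {p : ℕ} (hp : p.Prime) {x y z : ℤ} (hx : x ≠ 0) (hy : y ≠ 0) :
    hh p (x * y) z = hh p x z + hh p y z := by
  unfold hh; rw [vv_mul hp hx hy, ss_mul hp hx hy]; ring
lemma h2_mul {x y z : ℤ} (hx : x ≠ 0) (hy : y ≠ 0) :
    h2 (x * y) z = h2 x z + h2 y z := by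
  unfold h2; rw [vv_mul Nat.prime_two hx hy, ep_mul hx hy, om_mul hx hy]; ring
lemma hi_mul {x y z : ℤ} (hx : x ≠ 0) (hy : y ≠ 0) :
    hi (x * y) z = hi x z + hi y z := by
  unfold hi; rw [ng_mul hx hy]; ring
lemma hh_comm (p : ℕ) (x y : ℤ) : hh p x y = hh p y x := by unfold hh; ring
lemma h2_comm (x y : ℤ) : h2 x y = h2 y x := by unfold h2; ring
lemma hi_comm (x y : ℤ) : hi x y = hi y x := by unfold hi; ring

/-! values -/
lemma vv_unit {p : ℕ} (hp : p.Prime) {x : ℤ} (hx : ¬ (p : ℤ) ∣ x) : vv p x = 0 := by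
  unfold vv; rw [(vu_unit hp hx).1]; rfl
lemma ss_unit {p : ℕ} (hp : p.Prime) {x : ℤ} (hx : ¬ (p : ℤ) ∣ x) : ss p x = sg (jacobiSym x p) := by
  unfold ss; rw [(vu_unit hp hx).2]
lemma vu_self {p : ℕ} (hp : p.Prime) : padicValInt p (p : ℤ) = 1 ∧ uu p p = 1 := by
  have h : ¬ (p : ℤ) ∣ 1 := by
    intro h; exact hp.one_lt.ne' (by exact_mod_cast Int.eq_one_of_dvd_one (by positivity) h)
  simpa using uu_uniq hp 1 h
lemma vv_self {p : ℕ} (hp : p.Prime) : vv p p = 1 := by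
  unfold vv; rw [(vu_self hp).1]; rfl
lemma ss_self {p : ℕ} (hp : p.Prime) : ss p p = 0 := by
  unfold ss; rw [(vu_self hp).2]; simp [sg]
lemma not_dvd_of_ne {p q : ℕ} (hp : p.Prime) (hq : q.Prime) (h : p ≠ q) : ¬ (p : ℤ) ∣ q := by
  intro hd; exact h ((Nat.prime_dvd_prime_iff_eq hp hq).1 (by exact_mod_cast hd))
lemma not_dvd_neg_one {p : ℕ} (hp : p.Prime) : ¬ (p : ℤ) ∣ -1 := by
  intro h
  have h' : (p : ℤ) ∣ 1 := by simpa using h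
  exact hp.one_lt.ne' (by exact_mod_cast Int.eq_one_of_dvd_one (by positivity) h')
lemma two_not_dvd {p : ℕ} (hp : p.Prime) (h : p ≠ 2) : ¬ (2 : ℤ) ∣ p := by
  exact_mod_cast not_dvd_of_ne Nat.prime_two hp h.symm
lemma uu2_odd {x : ℤ} (h : ¬ (2 : ℤ) ∣ x) : uu 2 x = x := (vu_unit Nat.prime_two (by exact_mod_cast h)).2
lemma vv2_odd {x : ℤ} (h : ¬ (2 : ℤ) ∣ x) : vv 2 x = 0 := vv_unit Nat.prime_two (by exact_mod_cast h)
lemma vv2_two : vv 2 2 = 1 := by exact_mod_cast vv_self Nat.prime_two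
lemma uu2_two : uu 2 2 = 1 := by exact_mod_cast (vu_self Nat.prime_two).2
lemma ep_two : ep 2 = 0 := by unfold ep; rw [uu2_two]; decide
lemma om_two : om 2 = 0 := by unfold om; rw [uu2_two]; decide
lemma ep_neg : ep (-1) = 1 := by unfold ep; rw [uu2_odd (by norm_num)]; decide
lemma om_neg : om (-1) = 0 := by unfold om; rw [uu2_odd (by norm_num)]; decide
lemma vv2_neg : vv 2 (-1) = 0 := vv2_odd (by norm_num)
lemma ep_odd {x : ℤ} (h : ¬ (2 : ℤ) ∣ x) : ep x = sg (ZMod.χ₄ (x : ℤ)) := by unfold ep; rw [uu2_odd h]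
lemma om_odd {x : ℤ} (h : ¬ (2 : ℤ) ∣ x) : om x = sg (ZMod.χ₈ (x : ℤ)) := by unfold om; rw [uu2_odd h]

lemma ss_neg_one {p : ℕ} (hp : p.Prime) (h : p ≠ 2) : ss p (-1) = ep p := by
  rw [ss_unit hp (not_dvd_neg_one hp), ep_odd (two_not_dvd hp h),
    jacobiSym.at_neg_one (hp.odd_of_ne_two h)]
  simp
lemma ss_two {p : ℕ} (hp : p.Prime) (h : p ≠ 2) : ss p 2 = om p := by
  rw [ss_unit hp (by exact_mod_cast not_dvd_of_ne hp Nat.prime_two h), om_odd (two_not_dvd hp h),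
    jacobiSym.at_two (hp.odd_of_ne_two h)]
  simp

lemma recip {p q : ℕ} (hp : p.Prime) (hq : q.Prime) (h2 : p ≠ 2) (h3 : q ≠ 2) (hne : p ≠ q) :
    ss p q + ss q p = ep p * ep q := by
  rw [ss_unit hp (not_dvd_of_ne hp hq hne), ss_unit hq (not_dvd_of_ne hq hp hne.symm),
    ep_odd (two_not_dvd hp h2), ep_odd (two_not_dvd hq h3),
    ZMod.χ₄_int_eq_if_mod_four, ZMod.χ₄_int_eq_if_mod_four]
  have o1 := hp.odd_of_ne_two h2
  have o2 := hq.odd_of_ne_two h3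
  have e1 := Nat.odd_iff.1 o1
  have e2 := Nat.odd_iff.1 o2
  have n1 : (p : ℤ) % 2 ≠ 0 := by omega
  have n2 : (q : ℤ) % 2 ≠ 0 := by omega
  simp only [n1, n2, if_false]
  rcases (by omega : p % 4 = 1 ∨ p % 4 = 3) with hp4 | hp4
  · rw [jacobiSym.quadratic_reciprocity_one_mod_four hp4 o2]
    have : (p : ℤ) % 4 = 1 := by omega
    simp only [this, if_true]
    rw [CharTwo.add_self_eq_zero]; simp [sg]
  · rcases (by omega : q % 4 = 1 ∨ q % 4 = 3) with hq4 | hq4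
    · rw [jacobiSym.quadratic_reciprocity_one_mod_four hq4 o1]
      have : (q : ℤ) % 4 = 1 := by omega
      simp only [this, if_true]
      rw [CharTwo.add_self_eq_zero]; simp [sg]
    · rw [jacobiSym.quadratic_reciprocity_three_mod_four hp4 hq4]
      have a1 : (q : ℤ) % 4 ≠ 1 := by omega
      have a2 : (p : ℤ) % 4 ≠ 1 := by omega
      simp only [a1, a2, if_false]
      rcases jac_pm hp (not_dvd_of_ne hp hq hne) with h | h <;> rw [h] <;> decide

/-! product formula -/
def FF (S : Finset ℕ) (x y : ℤ) : ZMod 2 := hi x y + h2 x y + ∑ p ∈ S, hh p x y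

lemma FF_comm (S) (x y : ℤ) : FF S x y = FF S y x := by
  unfold FF; rw [hi_comm, h2_comm]; congr 1; exact Finset.sum_congr rfl fun p _ => hh_comm p x y

lemma FF_mul {S : Finset ℕ} (hS : ∀ p ∈ S, p.Prime) {x y z : ℤ} (hx : x ≠ 0) (hy : y ≠ 0) :
    FF S (x * y) z = FF S x z + FF S y z := by
  unfold FF; rw [hi_mul hx hy, h2_mul hx hy,
    Finset.sum_congr rfl fun p hp => hh_mul (hS p hp) hx hy, Finset.sum_add_distrib]; ring

def gen (S : Finset ℕ) (x : ℤ) : Prop := x = -1 ∨ x = 2 ∨ ∃ p ∈ S, x = (p : ℤ)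

lemma ng_neg : ng (-1) = 1 := by decide
lemma ng_nat (n : ℕ) : ng n = 0 := by unfold ng; simp
lemma ng_two : ng 2 = 0 := by decide

lemma FF_gen {S : Finset ℕ} (hS : ∀ p ∈ S, p.Prime ∧ p ≠ 2) {x y : ℤ}
    (hx : gen S x) (hy : gen S y) : FF S x y = 0 := by
  have v1 : ∀ p ∈ S, vv p (-1) = 0 := fun p hp => vv_unit (hS p hp).1 (not_dvd_neg_one (hS p hp).1)
  have v2 : ∀ p ∈ S, vv p 2 = 0 := fun p hp => vv_unit (hS p hp).1
    (by exact_mod_cast not_dvd_of_ne (hS p hp).1 Nat.prime_two (hS p hp).2)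
  have v3 : ∀ q ∈ S, vv 2 q = 0 := fun q hq => vv2_odd (two_not_dvd (hS q hq).1 (hS q hq).2)
  have v4 : ∀ q ∈ S, ∀ p ∈ S, p ≠ q → vv p q = 0 := fun q hq p hp hne =>
    vv_unit (hS p hp).1 (not_dvd_of_ne (hS p hp).1 (hS q hq).1 hne)
  have key1 : ∀ y : ℤ, (∀ p ∈ S, vv p y = 0) → y = -1 ∨ y = 2 → ∀ q ∈ S, FF S q y = 0 := by
    intro y hy hy' q hq
    unfold FF
    rw [Finset.sum_eq_single_of_mem q hq (fun p hp hne => by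
      unfold hh; rw [hy p hp, v4 q hq p hp hne]; ring)]
    unfold hh hi h2
    rw [hy q hq, v3 q hq, vv_self (hS q hq).1, ng_nat]
    rcases hy' with rfl | rfl
    · rw [vv2_neg, ep_neg, om_neg, ss_neg_one (hS q hq).1 (hS q hq).2]
      linear_combination ep (q : ℤ) * two0
    · rw [vv2_two, ep_two, om_two, ss_two (hS q hq).1 (hS q hq).2]
      linear_combination om (q : ℤ) * two0
  have key0 : ∀ x y : ℤ, x = -1 ∨ x = 2 → y = -1 ∨ y = 2 → FF S x y = 0 := by
    intro x y hx hy
    unfold FF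
    rw [Finset.sum_eq_zero (fun p hp => by
      unfold hh
      have a : vv p x = 0 := by rcases hx with rfl | rfl; exacts [v1 p hp, v2 p hp]
      have b : vv p y = 0 := by rcases hy with rfl | rfl; exacts [v1 p hp, v2 p hp]
      rw [a, b]; ring)]
    unfold hi h2
    rcases hx with rfl | rfl <;> rcases hy with rfl | rfl <;>
      simp only [ng_neg, ng_two, ep_neg, ep_two, om_neg, om_two, vv2_neg, vv2_two] <;> decide
  have hv : ∀ y : ℤ, y = -1 ∨ y = 2 → ∀ p ∈ S, vv p y = 0 := by
    rintro y (rfl | rfl); exacts [v1, v2]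
  rw [gen, ← or_assoc] at hx hy
  rcases hx with hx | ⟨p, hp, rfl⟩ <;> rcases hy with hy | ⟨q, hq, rfl⟩
  · exact key0 _ _ hx hy
  · rw [FF_comm]; exact key1 _ (hv _ hx) hx q hq
  · exact key1 _ (hv _ hy) hy p hp
  · by_cases hpq : p = q
    · subst hpq
      unfold FF
      rw [Finset.sum_eq_single_of_mem p hp (fun r hr hne => by
        unfold hh; rw [v4 p hp r hr hne]; ring)]
      unfold hh hi h2
      rw [v3 p hp, vv_self (hS p hp).1, ss_self (hS p hp).1, ng_nat,
        ss_neg_one (hS p hp).1 (hS p hp).2]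
      generalize ep p = e; generalize om p = f; revert e f; decide
    · unfold FF
      rw [Finset.sum_eq_add_of_mem p q hp hq hpq (fun r hr hne => by
        unfold hh; rw [v4 p hp r hr hne.1, v4 q hq r hr hne.2]; ring)]
      unfold hh hi h2
      rw [v3 p hp, v3 q hq, vv_self (hS p hp).1, vv_self (hS q hq).1, v4 q hq p hp hpq,
        v4 p hp q hq (Ne.symm hpq), ng_nat, ng_nat]
      have := recip (hS p hp).1 (hS q hq).1 (hS p hp).2 (hS q hq).2 hpq
      linear_combination this + (ep (p:ℤ) * ep (q:ℤ)) * two0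

lemma FF_ind {S : Finset ℕ} (hS : ∀ p ∈ S, p.Prime ∧ p ≠ 2) {y : ℤ}
    (hy : ∀ x, gen S x → FF S x y = 0) (x : ℤ) (hx : x ≠ 0)
    (hd : ∀ p : ℕ, p.Prime → p ≠ 2 → (p : ℤ) ∣ x → p ∈ S) : FF S x y = 0 := by
  have hS' : ∀ p ∈ S, p.Prime := fun p hp => (hS p hp).1
  have one : FF S 1 y = 0 := by
    have := FF_mul (S := S) hS' (x := 1) (y := 1) (z := y) one_ne_zero one_ne_zero
    simpa using this
  have nat : ∀ n : ℕ, n ≠ 0 → (∀ p : ℕ, p.Prime → p ≠ 2 → p ∣ n → p ∈ S) → FF S n y = 0 := by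
    intro n
    induction n using induction_on_primes with
    | zero => intro h; exact absurd rfl h
    | one => intro _ _; simpa using one
    | prime_mul p a hp ih =>
      intro h0 hd
      have ha : a ≠ 0 := right_ne_zero_of_mul h0
      push_cast
      rw [FF_mul hS' (by exact_mod_cast hp.ne_zero) (by exact_mod_cast ha),
        ih ha (fun q hq h2 hqd => hd q hq h2 (hqd.mul_left p)), add_zero]
      apply hy
      by_cases h : p = 2
      · right; left; rw [h]; rfl
      · right; right; exact ⟨p, hd p hp h (Dvd.intro _ rfl), rfl⟩
  have hnat := nat x.natAbs (by simpa using hx) (fun p hp h2 hpd => hd p hp h2 (Int.natCast_dvd.2 hpd))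
  rcases Int.natAbs_eq x with h | h
  · rw [h]; exact hnat
  · rw [h, neg_eq_neg_one_mul, FF_mul hS' (by norm_num) (by simpa using hx), hnat, add_zero]
    exact hy _ (Or.inl rfl)

theorem product_formula {S : Finset ℕ} (hS : ∀ p ∈ S, p.Prime ∧ p ≠ 2) {x y : ℤ}
    (hx : x ≠ 0) (hy : y ≠ 0)
    (hdx : ∀ p : ℕ, p.Prime → p ≠ 2 → (p : ℤ) ∣ x → p ∈ S)
    (hdy : ∀ p : ℕ, p.Prime → p ≠ 2 → (p : ℤ) ∣ y → p ∈ S) : FF S x y = 0 := by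
  refine FF_ind hS (fun g hg => ?_) x hx hdx
  rw [FF_comm]
  refine FF_ind hS (fun g' hg' => FF_gen hS hg' hg) y hy hdy
/-! local necessity -/
lemma ss_congr {p : ℕ} {x y : ℤ} (h : uu p x ≡ uu p y [ZMOD p]) : ss p x = ss p y := by
  unfold ss
  rw [jacobiSym.mod_left, h, ← jacobiSym.mod_left]

lemma vv_sq {p : ℕ} (hp : p.Prime) {x : ℤ} (hx : x ≠ 0) : vv p (x ^ 2) = 0 := by
  rw [sq, vv_mul hp hx hx]; exact CharTwo.add_self_eq_zero _
lemma ss_sq {p : ℕ} (hp : p.Prime) {x : ℤ} (hx : x ≠ 0) : ss p (x ^ 2) = 0 := by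
  rw [sq, ss_mul hp hx hx]; exact CharTwo.add_self_eq_zero _
lemma hh_sq {p : ℕ} (hp : p.Prime) {x y u : ℤ} (hy : y ≠ 0) (hu : u ≠ 0) :
    hh p x (y * u ^ 2) = hh p x y := by
  have hu2 : u ^ 2 ≠ 0 := pow_ne_zero _ hu
  unfold hh
  rw [vv_mul hp hy hu2, ss_mul hp hy hu2, vv_sq hp hu, ss_sq hp hu, add_zero, add_zero]
lemma hh_sq0 {p : ℕ} (hp : p.Prime) {x u : ℤ} (hu : u ≠ 0) : hh p x (u ^ 2) = 0 := by
  unfold hh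
  rw [vv_sq hp hu, ss_sq hp hu]; ring

lemma hh_neg {p : ℕ} (hp : p.Prime) {x : ℤ} (hx : x ≠ 0) : hh p x (-x) = 0 := by
  rw [neg_eq_neg_one_mul]
  unfold hh
  rw [vv_mul hp (by norm_num) hx, ss_mul hp (by norm_num) hx, vv_unit hp (not_dvd_neg_one hp)]
  generalize ss p (-1) = e; generalize ss p x = s; generalize vv p x = v
  revert e s v; decide

lemma stein_lt {p : ℕ} (hp : p.Prime) {X Y Z : ℤ} (hX : X ≠ 0) (hY : Y ≠ 0) (hZ : Z ≠ 0)
    (h : X + Y = Z ^ 2) (hlt : padicValInt p X < padicValInt p Y) : hh p X Y = 0 := by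
  obtain ⟨x1, x2⟩ := uu_spec hp hX
  obtain ⟨y1, y2⟩ := uu_spec hp hY
  obtain ⟨d, hd⟩ := Nat.exists_eq_add_of_lt hlt
  have e : Z ^ 2 = (p : ℤ) ^ padicValInt p X * (uu p X + p * (p ^ d * uu p Y)) := by
    rw [← h]
    conv_lhs => rw [x1, y1, hd]
    ring
  have hn : ¬ (p : ℤ) ∣ (uu p X + p * (p ^ d * uu p Y)) := fun hh =>
    x2 ((Int.dvd_add_left (Dvd.intro _ rfl)).1 hh)
  have hu := uu_uniq hp (padicValInt p X) hn
  rw [← e] at hu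
  have hv : vv p X = 0 := by
    rw [← vv_sq hp hZ]; unfold vv; rw [hu.1]
  have hs : ss p X = 0 := by
    rw [← ss_sq hp hZ]; apply ss_congr; rw [hu.2]
    exact (Int.modEq_iff_dvd.2 ⟨p ^ d * uu p Y, by ring⟩)
  unfold hh; rw [hv, hs]; ring

lemma stein {p : ℕ} (hp : p.Prime) {X Y Z : ℤ} (hX : X ≠ 0) (hY : Y ≠ 0) (hZ : Z ≠ 0)
    (h : X + Y = Z ^ 2) : hh p X Y = 0 := by
  rcases lt_trichotomy (padicValInt p X) (padicValInt p Y) with hlt | heq | hlt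
  · exact stein_lt hp hX hY hZ h hlt
  · obtain ⟨x1, x2⟩ := uu_spec hp hX
    obtain ⟨y1, y2⟩ := uu_spec hp hY
    have hvv : vv p X = vv p Y := by unfold vv; rw [heq]
    by_cases hv : vv p X = 0
    · unfold hh; rw [← hvv, hv]; ring
    have hd : (p : ℤ) ∣ uu p X + uu p Y := by
      by_contra hn
      have hu := uu_uniq hp (padicValInt p X) hn
      have e : (p : ℤ) ^ padicValInt p X * (uu p X + uu p Y) = Z ^ 2 := by
        rw [← h, mul_add]
        conv_rhs => rw [x1, y1, ← heq]
      rw [e] at hu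
      apply hv
      rw [← vv_sq hp hZ]; unfold vv; rw [hu.1]
    have hs : ss p Y = ss p (-1) + ss p X := by
      rw [← ss_mul hp (by norm_num) hX]
      apply ss_congr
      rw [(vu_mul hp (by norm_num) hX).2, (vu_unit hp (not_dvd_neg_one hp)).2]
      apply Int.modEq_iff_dvd.2
      rw [show -1 * uu p X - uu p Y = -(uu p X + uu p Y) by ring]
      exact (dvd_neg).2 hd
    unfold hh; rw [← hvv, hs]
    generalize ss p (-1) = e; generalize ss p X = s; generalize vv p X = v
    revert e s v; decide
  · rw [hh_comm]; exact stein_lt hp hY hX hZ (by rw [add_comm]; exact h) hlt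

lemma loc_nec {p : ℕ} (hp : p.Prime) {x y z u v : ℤ} (hx : x ≠ 0) (hy : y ≠ 0)
    (h : z ^ 2 = x * u ^ 2 + y * v ^ 2) (hne : ¬ (z = 0 ∧ u = 0 ∧ v = 0)) : hh p x y = 0 := by
  by_cases hu : u = 0
  · subst hu
    have hv : v ≠ 0 := by
      rintro rfl; apply hne
      refine ⟨?_, rfl, rfl⟩
      have : z ^ 2 = 0 := by rw [h]; ring
      exact pow_eq_zero_iff (two_ne_zero) |>.1 this
    have e : y * v ^ 2 = z ^ 2 := by rw [h]; ring
    have hz : z ≠ 0 := by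
      rintro rfl
      have : y * v ^ 2 ≠ 0 := mul_ne_zero hy (pow_ne_zero _ hv)
      apply this; rw [e]; ring
    rw [← hh_sq hp hy hv, e]; exact hh_sq0 hp hz
  by_cases hv : v = 0
  · subst hv
    have e : x * u ^ 2 = z ^ 2 := by rw [h]; ring
    have hz : z ≠ 0 := by
      rintro rfl
      have : x * u ^ 2 ≠ 0 := mul_ne_zero hx (pow_ne_zero _ hu)
      apply this; rw [e]; ring
    rw [hh_comm, ← hh_sq hp hx hu, e]; exact hh_sq0 hp hz
  have hX : x * u ^ 2 ≠ 0 := mul_ne_zero hx (pow_ne_zero _ hu)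
  have hY : y * v ^ 2 ≠ 0 := mul_ne_zero hy (pow_ne_zero _ hv)
  rw [← hh_sq hp hy hv, hh_comm, ← hh_sq hp hx hu, hh_comm]
  by_cases hz : z = 0
  · subst hz
    have : y * v ^ 2 = -(x * u ^ 2) := by linarith
    rw [this]; exact hh_neg hp hX
  · exact stein hp hX hY hz h.symm

lemma hi_nec {x y z u v : ℤ} (h : z ^ 2 = x * u ^ 2 + y * v ^ 2)
    (hne : ¬ (z = 0 ∧ u = 0 ∧ v = 0)) : hi x y = 0 := by
  by_contra hc
  have hxy : x < 0 ∧ y < 0 := by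
    unfold hi ng at hc
    by_contra hcc
    apply hc
    split_ifs with h1 h2 <;> first | rfl | exact absurd ⟨h1, h2⟩ hcc
  apply hne
  have a1 : x * u ^ 2 ≤ 0 := mul_nonpos_of_nonpos_of_nonneg hxy.1.le (sq_nonneg _)
  have a2 : y * v ^ 2 ≤ 0 := mul_nonpos_of_nonpos_of_nonneg hxy.2.le (sq_nonneg _)
  have hz2 : 0 ≤ z ^ 2 := sq_nonneg z
  have b1 : x * u ^ 2 = 0 := by linarith
  have b2 : y * v ^ 2 = 0 := by linarith
  have b3 : z ^ 2 = 0 := by linarith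
  simp [hxy.1.ne, hxy.2.ne] at b1 b2 b3
  exact ⟨b3, b1, b2⟩

/-! descent -/
lemma sq_mod_of_primes (x : ℤ) (n : ℕ) (hn : Squarefree n)
    (h : ∀ p : ℕ, p.Prime → p ∣ n → ∃ s : ℤ, (p : ℤ) ∣ s ^ 2 - x) : ∃ s : ℤ, (n : ℤ) ∣ s ^ 2 - x := by
  induction n using induction_on_primes with
  | zero => exact absurd hn (by simp)
  | one => exact ⟨0, by simp⟩
  | prime_mul p a hp ih =>
    obtain ⟨s, hs⟩ := h p hp (Dvd.intro _ rfl)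
    obtain ⟨r, hr⟩ := ih (hn.of_mul_right) (fun q hq hd => h q hq (hd.mul_left _))
    have hco : Nat.Coprime p a := Nat.coprime_of_squarefree_mul hn
    have hco' : IsCoprime (p : ℤ) (a : ℤ) := Nat.isCoprime_iff_coprime.2 hco
    obtain ⟨c, d, hcd⟩ := hco'
    refine ⟨s * (d * a) + r * (c * p), ?_⟩
    push_cast
    apply IsCoprime.mul_dvd ⟨c, d, hcd⟩
    · have : (s * (d * a) + r * (c * p)) ^ 2 - x = (s ^ 2 - x) +
        p * c * ((r - s) * (2 * s + (r - s) * (c * p))) := by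
        have : d * a = 1 - c * (p : ℤ) := by linarith
        rw [this]; ring
      rw [this]
      exact dvd_add hs ((Dvd.intro c rfl : (p : ℤ) ∣ p * c).mul_right _)
    · have : (s * (d * a) + r * (c * p)) ^ 2 - x = (r ^ 2 - x) +
        a * d * ((s - r) * (2 * r + (s - r) * (d * a))) := by
        have : c * (p : ℤ) = 1 - d * a := by linarith
        rw [this]; ring
      rw [this]
      exact dvd_add hr ((Dvd.intro d rfl : (a : ℤ) ∣ a * d).mul_right _)

lemma vv_one_of_sqf {p : ℕ} (hp : p.Prime) {x : ℤ} (hx : Squarefree x) (hd : (p : ℤ) ∣ x) :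
    vv p x = 1 ∧ uu p x = x / p := by
  obtain ⟨k, rfl⟩ := hd
  have hk : ¬ (p : ℤ) ∣ k := by
    rintro ⟨l, rfl⟩
    have := hx p ⟨l, by ring⟩
    exact (Nat.prime_iff_prime_int.1 hp).not_isUnit this
  have := uu_uniq hp 1 hk
  rw [pow_one] at this
  refine ⟨by unfold vv; rw [this.1]; rfl, ?_⟩
  rw [this.2, Int.mul_ediv_cancel_left]
  exact_mod_cast hp.ne_zero

def sol (x y : ℤ) : Prop := ∃ z u v : ℤ, z ^ 2 = x * u ^ 2 + y * v ^ 2 ∧ ¬ (z = 0 ∧ u = 0 ∧ v = 0)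

lemma sol_comm {x y : ℤ} (h : sol x y) : sol y x := by
  obtain ⟨z, u, v, h, hn⟩ := h
  exact ⟨z, v, u, by rw [h]; ring, fun hh => hn ⟨hh.1, hh.2.2, hh.2.1⟩⟩

lemma hi_sq {x y u : ℤ} (hy : y ≠ 0) (hu : u ≠ 0) : hi x (y * u ^ 2) = hi x y := by
  unfold hi; rw [ng_mul hy (pow_ne_zero _ hu), sq, ng_mul hu hu, CharTwo.add_self_eq_zero, add_zero]

lemma descent (n : ℕ) : ∀ x y : ℤ, x.natAbs + y.natAbs ≤ n → x ≠ 0 → y ≠ 0 →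
    (∀ p : ℕ, p.Prime → p ≠ 2 → hh p x y = 0) → hi x y = 0 → sol x y := by
  induction n with
  | zero => intro x y h hx hy; exact absurd (Int.natAbs_eq_zero.1 (by omega)) hx
  | succ n ih =>
    -- non-squarefree reduction
    have red : ∀ x y : ℤ, x.natAbs + y.natAbs ≤ n + 1 → x ≠ 0 → y ≠ 0 →
        (∀ p : ℕ, p.Prime → p ≠ 2 → hh p x y = 0) → hi x y = 0 → ¬ Squarefree y → sol x y := by
      intro x y hle hx hy hp h0 hsf
      simp only [Squarefree, not_forall] at hsf
      obtain ⟨d, ⟨k, hk⟩, hd⟩ := hsf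
      have hd0 : d ≠ 0 := by rintro rfl; apply hy; rw [hk]; ring
      have hk0 : k ≠ 0 := by rintro rfl; apply hy; rw [hk]; ring
      have hk' : y = k * d ^ 2 := by rw [hk]; ring
      have hlt : k.natAbs < y.natAbs := by
        rw [hk', Int.natAbs_mul, Int.natAbs_pow]
        have h1 : d.natAbs ≠ 1 := fun h => hd (Int.isUnit_iff_natAbs_eq.2 h)
        have h2 : d.natAbs ≠ 0 := by simpa using hd0
        have h3 : 2 ≤ d.natAbs := by omega
        have h4 : k.natAbs ≠ 0 := by simpa using hk0
        have h5 : 1 ≤ k.natAbs := by omega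
        have h6 : 2 ^ 2 ≤ d.natAbs ^ 2 := Nat.pow_le_pow_left h3 2
        have h7 : k.natAbs * 2 ^ 2 ≤ k.natAbs * d.natAbs ^ 2 := Nat.mul_le_mul_left _ h6
        omega
      obtain ⟨z, u, v, he, hn⟩ := ih x k (by omega) hx hk0
        (fun p h1 h2 => by rw [← hh_sq h1 hk0 hd0, ← hk']; exact hp p h1 h2)
        (by rw [← hi_sq hk0 hd0, ← hk']; exact h0)
      refine ⟨d * z, d * u, v, ?_, ?_⟩
      · rw [hk']; linear_combination d ^ 2 * he
      · rintro ⟨a1, a2, a3⟩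
        apply hn
        exact ⟨(mul_eq_zero.1 a1).resolve_left hd0, (mul_eq_zero.1 a2).resolve_left hd0, a3⟩
    have main : ∀ x y : ℤ, x.natAbs + y.natAbs ≤ n + 1 → x.natAbs ≤ y.natAbs → x ≠ 0 → y ≠ 0 →
        (∀ p : ℕ, p.Prime → p ≠ 2 → hh p x y = 0) → hi x y = 0 → sol x y := by
      intro x y hle hxy hx hy hp h0
      by_cases hsy : Squarefree y
      swap
      · exact red x y hle hx hy hp h0 hsy
      by_cases hy1 : y.natAbs = 1
      · have hx1 : x.natAbs = 1 := by
          have : x.natAbs ≠ 0 := by simpa using hx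
          omega
        rcases Int.natAbs_eq_iff.1 hx1 with h1 | h1
        · exact ⟨1, 1, 0, by rw [h1]; norm_num, by norm_num⟩
        rcases Int.natAbs_eq_iff.1 hy1 with h2 | h2
        · exact ⟨1, 0, 1, by rw [h2]; norm_num, by norm_num⟩
        · exfalso; rw [h1, h2] at h0; revert h0; decide
      have hy2 : 2 ≤ y.natAbs := by
        have : y.natAbs ≠ 0 := by simpa using hy
        omega
      -- x is a square mod y
      obtain ⟨s0, hs0⟩ := sq_mod_of_primes x y.natAbs (Int.squarefree_natAbs.2 hsy) (by
        intro p hpp hpy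
        have hpy' : (p : ℤ) ∣ y := Int.natCast_dvd.2 hpy
        by_cases hpx : (p : ℤ) ∣ x
        · exact ⟨0, by simpa using hpx⟩
        by_cases h2 : p = 2
        · subst h2
          refine ⟨1, ?_⟩
          push_cast at hpx ⊢
          omega
        have := hp p hpp h2
        unfold hh at this
        rw [vv_unit hpp hpx, (vv_one_of_sqf hpp hsy hpy').1, ss_unit hpp hpx] at this
        have hj : jacobiSym x p = 1 := by
          rw [← sg_inj (jac_pm hpp hpx)]; linear_combination this
        have := Fact.mk hpp
        rw [← jacobiSym.legendreSym.to_jacobiSym, legendreSym.eq_one_iff] at hj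
        · obtain ⟨r, hr⟩ := hj
          obtain ⟨r, rfl⟩ := ZMod.intCast_surjective r
          refine ⟨r, ?_⟩
          rw [← ZMod.intCast_zmod_eq_zero_iff_dvd]
          push_cast; rw [hr]; ring
        · rwa [Ne, ZMod.intCast_zmod_eq_zero_iff_dvd])
      rw [Int.natCast_natAbs, abs_dvd] at hs0
      -- small representative
      obtain ⟨s, hs, hsb⟩ : ∃ s : ℤ, y ∣ s ^ 2 - x ∧ 2 * s.natAbs ≤ y.natAbs := by
        refine ⟨s0.bmod y.natAbs, ?_, ?_⟩
        · have h1 : y ∣ s0.bmod y.natAbs - s0 := by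
            have : ((y.natAbs : ℕ) : ℤ) ∣ s0.bmod y.natAbs - s0 := by
              exact Int.dvd_bmod_sub_self
            rwa [Int.natCast_natAbs, abs_dvd] at this
          have : s0.bmod y.natAbs ^ 2 - x = (s0 ^ 2 - x) +
            (s0.bmod y.natAbs - s0) * (s0.bmod y.natAbs + s0) := by ring
          rw [this]
          exact dvd_add hs0 (h1.mul_right _)
        · have b1 := Int.bmod_lt (x := s0) (m := y.natAbs) (by omega)
          have b2 := Int.le_bmod (x := s0) (m := y.natAbs) (by omega)
          omega
      obtain ⟨k, hk⟩ := hs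
      by_cases hk0 : k = 0
      · subst hk0
        exact ⟨s, 1, 0, by linarith, by norm_num⟩
      have hklt : k.natAbs < y.natAbs := by
        have e1 : y.natAbs * k.natAbs ≤ s.natAbs ^ 2 + x.natAbs := by
          rw [← Int.natAbs_mul, ← hk, ← Int.natAbs_pow]
          exact Int.natAbs_sub_le _ _
        by_contra hcc
        push Not at hcc
        have e2 : y.natAbs * y.natAbs ≤ y.natAbs * k.natAbs := Nat.mul_le_mul_left _ hcc
        have e3 : (2 * s.natAbs) ^ 2 ≤ y.natAbs ^ 2 := Nat.pow_le_pow_left hsb 2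
        have e4 : 2 * y.natAbs ≤ y.natAbs * y.natAbs := Nat.mul_le_mul_right _ hy2
        have e5 : (2 * s.natAbs) ^ 2 = 4 * s.natAbs ^ 2 := by ring
        have e6 : y.natAbs ^ 2 = y.natAbs * y.natAbs := by ring
        omega
      have hN : ∀ p : ℕ, p.Prime → p ≠ 2 → hh p x k = 0 := by
        intro p h1 h2
        have h3 : hh p x (y * k) = 0 := by
          refine loc_nec h1 hx (mul_ne_zero hy hk0) (z := s) (u := 1) (v := 1) ?_ (by norm_num)
          rw [← hk]; ring
        rw [hh_comm, hh_mul h1 hy hk0, hh_comm, hp p h1 h2, zero_add, hh_comm] at h3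
        exact h3
      have hI : hi x k = 0 := by
        have h3 : hi x (y * k) = 0 := by
          refine hi_nec (z := s) (u := 1) (v := 1) ?_ (by norm_num)
          rw [← hk]; ring
        rw [hi_comm, hi_mul hy hk0, hi_comm, h0, zero_add, hi_comm] at h3
        exact h3
      obtain ⟨z, u, v, he, hn⟩ := ih x k (by omega) hx hk0 hN hI
      by_cases hv : v = 0
      · subst hv
        exact ⟨z, u, 0, by rw [he]; ring, hn⟩
      · refine ⟨s * z + x * u, s * u + z, k * v, ?_, ?_⟩
        · linear_combination (s ^ 2 - x) * he + k * v ^ 2 * hk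
        · rintro ⟨-, -, h3⟩
          exact (mul_ne_zero hk0 hv) h3
    intro x y hle hx hy hp h0
    rcases le_total x.natAbs y.natAbs with h | h
    · exact main x y hle h hx hy hp h0
    · exact sol_comm (main y x (by omega) h hy hx (fun p h1 h2 => by rw [hh_comm]; exact hp p h1 h2)
        (by rw [hi_comm]; exact h0))

theorem ternary {x y : ℤ} (hx : x ≠ 0) (hy : y ≠ 0)
    (h : ∀ p : ℕ, p.Prime → p ≠ 2 → hh p x y = 0) (h0 : hi x y = 0) : sol x y :=
  descent _ x y le_rfl hx hy h h0
/-! approximation -/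
def mm (p : ℕ) : ℕ := if p = 2 then 8 else p

lemma mm_eq (p : ℕ) : mm p = p ∨ mm p = p ^ 3 := by
  unfold mm; split_ifs with h
  · right; rw [h]; norm_num
  · left; rfl

lemma mm_cop {p : ℕ} (hp : p.Prime) {u : ℤ} (hu : ¬ (p : ℤ) ∣ u) : IsCoprime (mm p : ℤ) u := by
  have h := (Nat.prime_iff_prime_int.1 hp).coprime_iff_not_dvd.2 hu
  rcases mm_eq p with e | e <;> rw [e]
  · exact h
  · push_cast; exact h.pow_left

lemma mm_pos {p : ℕ} (hp : p.Prime) : mm p ≠ 0 := by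
  rcases mm_eq p with e | e <;> rw [e]
  · exact hp.ne_zero
  · exact pow_ne_zero _ hp.ne_zero

lemma mm_pair {p q : ℕ} (hp : p.Prime) (hq : q.Prime) (h : p ≠ q) : Nat.Coprime (mm p) (mm q) := by
  have h := (Nat.coprime_primes hp hq).2 h
  rcases mm_eq p with e | e <;> rcases mm_eq q with e' | e' <;> rw [e, e']
  · exact h
  · exact h.pow_right _
  · exact h.pow_left _
  · exact (h.pow_left _).pow_right _

lemma dvd_mm (p : ℕ) : p ∣ mm p := by
  rcases mm_eq p with e | e <;> rw [e]
  exact Dvd.intro_left (p ^ 2) (by ring)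

lemma ex_res {p : ℕ} (hp : p.Prime) {w u : ℤ} (hw : ¬ (p : ℤ) ∣ w) (hu : ¬ (p : ℤ) ∣ u) :
    ∃ r : ℕ, (r : ℤ) * w ≡ u [ZMOD mm p] ∧ Nat.Coprime r (mm p) := by
  obtain ⟨y, x, hxy⟩ := mm_cop hp hw
  have hm : (mm p : ℤ) ≠ 0 := by exact_mod_cast mm_pos hp
  have h1 : (((x * u) % (mm p : ℤ)).toNat : ℤ) * w ≡ u [ZMOD mm p] := by
    rw [Int.toNat_of_nonneg (Int.emod_nonneg _ hm)]
    calc (x * u) % (mm p : ℤ) * w ≡ (x * u) * w [ZMOD mm p] := (Int.mod_modEq _ _).mul_right _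
      _ ≡ u [ZMOD mm p] := by
        apply Int.modEq_iff_dvd.2
        exact ⟨y * u, by linear_combination -u * hxy⟩
  refine ⟨_, h1, ?_⟩
  have hnd : ¬ (p : ℤ) ∣ (((x * u) % (mm p : ℤ)).toNat : ℤ) := by
    intro hd
    apply hu
    have h2 : (p : ℤ) ∣ (mm p : ℤ) := by exact_mod_cast dvd_mm p
    have h3 := h2.trans (Int.modEq_iff_dvd.1 h1)
    have := dvd_add h3 (hd.mul_right w)
    simpa using this
  exact (Nat.isCoprime_iff_coprime.1 (mm_cop hp hnd)).symm

lemma approx (S : Finset ℕ) (hS : ∀ p ∈ S, p.Prime) (T : ℕ → ℤ) (hT : ∀ p, T p ≠ 0)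
    (e : ℤ) (he : e = 1 ∨ e = -1) :
    ∃ (t : ℤ) (q : ℕ), t ≠ 0 ∧ q.Prime ∧ q ∉ S ∧ 2 < q ∧ ng t = ng e ∧
      (∀ p : ℕ, p.Prime → (p : ℤ) ∣ t → p ∈ S ∨ p = q) ∧
      ∀ p ∈ S, vv p t = vv p (T p) ∧ uu p t ≡ uu p (T p) [ZMOD mm p] := by
  classical
  let v : ℕ → ℕ := fun p => padicValInt p (T p)
  let w : ℕ → ℤ := fun p => e * ∏ r ∈ S.erase p, (r : ℤ) ^ v r
  have heu : IsUnit e := by rcases he with rfl | rfl <;> decide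
  have hw : ∀ p ∈ S, ¬ (p : ℤ) ∣ w p := by
    intro p hp hd
    have hpi := Nat.prime_iff_prime_int.1 (hS p hp)
    rcases hpi.dvd_or_dvd hd with h | h
    · exact hpi.not_isUnit (isUnit_of_dvd_unit h heu)
    · obtain ⟨r, hr, hdr⟩ := (hpi.dvd_finsetProd_iff _).1 h
      have hr' := Finset.mem_erase.1 hr
      exact not_dvd_of_ne (hS p hp) (hS r hr'.2) hr'.1.symm (hpi.dvd_of_dvd_pow hdr)
  have hres : ∀ p : ℕ, ∃ r : ℕ, p ∈ S → ((r : ℤ) * w p ≡ uu p (T p) [ZMOD mm p] ∧ Nat.Coprime r (mm p)) := by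
    intro p
    by_cases hp : p ∈ S
    · obtain ⟨r, hr⟩ := ex_res (hS p hp) (hw p hp) (uu_spec (hS p hp) (hT p)).2
      exact ⟨r, fun _ => hr⟩
    · exact ⟨0, fun h => absurd h hp⟩
  choose r hr using hres
  obtain ⟨k, hk⟩ := Nat.chineseRemainderOfFinset r mm S (fun p hp => mm_pos (hS p hp))
    (fun p hp q hq hne => mm_pair (hS p hp) (hS q hq) hne)
  have hM : ∏ p ∈ S, mm p ≠ 0 := Finset.prod_ne_zero_iff.2 fun p hp => mm_pos (hS p hp)
  have : NeZero (∏ p ∈ S, mm p) := ⟨hM⟩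
  have hkc : Nat.Coprime k (∏ p ∈ S, mm p) := by
    apply Nat.Coprime.prod_right
    intro p hp
    have h1 := hk p hp
    have h2 := (hr p hp).2
    unfold Nat.Coprime at h2 ⊢
    rw [h1.gcd_eq, h2]
  obtain ⟨q, hq, hqp, hqk⟩ := Nat.forall_exists_prime_gt_and_eq_mod
    ((ZMod.isUnit_iff_coprime k _).2 hkc) (2 + ∑ p ∈ S, p)
  have hqS : ∀ p ∈ S, p < q := by
    intro p hp
    have := Finset.single_le_sum (f := fun p : ℕ => p) (fun i _ => Nat.zero_le i) hp
    omega
  have hqS' : q ∉ S := fun h => lt_irrefl _ (hqS q h)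
  have hq0 : (q : ℤ) ≠ 0 := by exact_mod_cast hqp.ne_zero
  have hP0 : ∏ r ∈ S, (r : ℤ) ^ v r ≠ 0 := Finset.prod_ne_zero_iff.2 fun p hp =>
    pow_ne_zero _ (by exact_mod_cast (hS p hp).ne_zero)
  have hPpos : 0 < ∏ r ∈ S, (r : ℤ) ^ v r := Finset.prod_pos fun p hp =>
    pow_pos (by exact_mod_cast (hS p hp).pos) _
  refine ⟨e * ((∏ r ∈ S, (r : ℤ) ^ v r) * q), q, mul_ne_zero heu.ne_zero (mul_ne_zero hP0 hq0),
    hqp, hqS', by omega, ?_, ?_, ?_⟩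
  · rw [ng_mul heu.ne_zero (mul_ne_zero hP0 hq0)]
    have : ng ((∏ r ∈ S, (r : ℤ) ^ v r) * q) = 0 := by
      unfold ng; rw [if_neg (mul_pos hPpos (by exact_mod_cast hqp.pos)).le.not_gt]
    rw [this, add_zero]
  · intro p hp hd
    have hpi := Nat.prime_iff_prime_int.1 hp
    rcases hpi.dvd_or_dvd hd with h | h
    · exact absurd (isUnit_of_dvd_unit h heu) hpi.not_isUnit
    rcases hpi.dvd_or_dvd h with h | h
    · obtain ⟨r, hr, hdr⟩ := (hpi.dvd_finsetProd_iff _).1 h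
      left
      have := hpi.dvd_of_dvd_pow hdr
      have : p = r := by
        by_contra hne
        exact not_dvd_of_ne hp (hS r hr) hne this
      rwa [this]
    · right
      by_contra hne
      exact not_dvd_of_ne hp hqp hne h
  · intro p hp
    have hpi := Nat.prime_iff_prime_int.1 (hS p hp)
    have e1 : e * ((∏ r ∈ S, (r : ℤ) ^ v r) * q) = (p : ℤ) ^ v p * (q * w p) := by
      simp only [w]
      rw [← Finset.mul_prod_erase S _ hp]; ring
    have hn : ¬ (p : ℤ) ∣ q * w p := by
      intro h
      rcases hpi.dvd_or_dvd h with h | h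
      · exact not_dvd_of_ne (hS p hp) hqp (hqS p hp).ne h
      · exact hw p hp h
    obtain ⟨b1, b2⟩ := uu_uniq (hS p hp) (v p) hn
    rw [e1]
    refine ⟨by unfold vv; rw [b1], ?_⟩
    rw [b2]
    refine Int.ModEq.trans (Int.ModEq.mul_right _ ?_) (hr p hp).1
    have h1 : q ≡ k [MOD mm p] := by
      have := (ZMod.natCast_eq_natCast_iff _ _ _).1 hqk
      exact this.of_dvd (Finset.dvd_prod_of_mem mm hp)
    have := h1.trans (hk p hp)
    exact Int.natCast_modEq_iff.2 this

lemma ep_congr {x y : ℤ} (h : uu 2 x ≡ uu 2 y [ZMOD 8]) : ep x = ep y := by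
  unfold ep
  have : ((uu 2 x : ℤ) : ZMod 4) = ((uu 2 y : ℤ) : ZMod 4) :=
    (ZMod.intCast_eq_intCast_iff _ _ 4).2 (h.of_dvd (by norm_num))
  rw [this]
lemma om_congr {x y : ℤ} (h : uu 2 x ≡ uu 2 y [ZMOD 8]) : om x = om y := by
  unfold om
  have : ((uu 2 x : ℤ) : ZMod 8) = ((uu 2 y : ℤ) : ZMod 8) :=
    (ZMod.intCast_eq_intCast_iff _ _ 8).2 h
  rw [this]

lemma hh_unit {p : ℕ} (hp : p.Prime) {x y : ℤ} (hx : ¬ (p : ℤ) ∣ x) (hy : ¬ (p : ℤ) ∣ y) :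
    hh p x y = 0 := by
  unfold hh; rw [vv_unit hp hx, vv_unit hp hy]; ring

lemma hh_congr {p : ℕ} (hp : p.Prime) {a b t s : ℤ} (ha : a ≠ 0) (hb : b ≠ 0) (ht : t ≠ 0)
    (hs : s ≠ 0) (hv : vv p t = vv p s) (hu : ss p t = ss p s) :
    hh p (a * t) (b * t) = hh p (a * s) (b * s) := by
  unfold hh
  simp only [vv_mul hp, ss_mul hp, ha, hb, ht, hs, hv, hu, ne_eq, not_false_eq_true]
lemma h2_congr {a b t s : ℤ} (ha : a ≠ 0) (hb : b ≠ 0) (ht : t ≠ 0)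
    (hs : s ≠ 0) (hv : vv 2 t = vv 2 s) (hu : ep t = ep s) (ho : om t = om s) :
    h2 (a * t) (b * t) = h2 (a * s) (b * s) := by
  unfold h2
  simp only [vv_mul Nat.prime_two, ep_mul, om_mul, ha, hb, ht, hs, hv, hu, ho, ne_eq, not_false_eq_true]
lemma hi_congr {a b t s : ℤ} (ha : a ≠ 0) (hb : b ≠ 0) (ht : t ≠ 0)
    (hs : s ≠ 0) (hv : ng t = ng s) :
    hi (a * t) (b * t) = hi (a * s) (b * s) := by
  unfold hi
  simp only [ng_mul, ha, hb, ht, hs, hv, ne_eq, not_false_eq_true]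

/-- one binary form, all symbols trivial except possibly at q -/
lemma close_q {S : Finset ℕ} (hS : ∀ p ∈ S, p.Prime ∧ p ≠ 2) {q : ℕ} (hq : q.Prime) (hq2 : q ≠ 2)
    (hqS : q ∉ S) {x y : ℤ} (hx : x ≠ 0) (hy : y ≠ 0)
    (hdx : ∀ p : ℕ, p.Prime → p ≠ 2 → (p : ℤ) ∣ x → p ∈ S ∨ p = q)
    (hdy : ∀ p : ℕ, p.Prime → p ≠ 2 → (p : ℤ) ∣ y → p ∈ S ∨ p = q)
    (h0 : hi x y = 0) (h20 : h2 x y = 0) (hp : ∀ p ∈ S, hh p x y = 0) : sol x y := by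
  have hF := product_formula (S := insert q S) (x := x) (y := y) (by
    intro p hp
    rcases Finset.mem_insert.1 hp with rfl | h
    · exact ⟨hq, hq2⟩
    · exact hS p h) hx hy
    (fun p h1 h2 h3 => Finset.mem_insert.2 (hdx p h1 h2 h3).symm)
    (fun p h1 h2 h3 => Finset.mem_insert.2 (hdy p h1 h2 h3).symm)
  unfold FF at hF
  rw [Finset.sum_insert hqS, Finset.sum_eq_zero hp, h0, h20] at hF
  have hhq : hh q x y = 0 := by simpa using hF
  refine ternary hx hy (fun p h1 h2 => ?_) h0
  by_cases hpS : p ∈ S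
  · exact hp p hpS
  by_cases hpq : p = q
  · rw [hpq]; exact hhq
  · refine hh_unit h1 (fun h => ?_) (fun h => ?_)
    · rcases hdx p h1 h2 h with h | h
      exacts [hpS h, hpq h]
    · rcases hdy p h1 h2 h with h | h
      exacts [hpS h, hpq h]

theorem global {a b c d : ℤ} (ha : a ≠ 0) (hb : b ≠ 0) (hc : c ≠ 0) (hd : d ≠ 0)
    (Hi : ∃ t ≠ 0, hi (a * t) (b * t) = 0 ∧ hi (c * t) (d * t) = 0)
    (H2 : ∃ t ≠ 0, h2 (a * t) (b * t) = 0 ∧ h2 (c * t) (d * t) = 0)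
    (Hp : ∀ p : ℕ, p.Prime → p ≠ 2 → ∃ t ≠ 0, hh p (a * t) (b * t) = 0 ∧ hh p (c * t) (d * t) = 0) :
    ∃ t ≠ 0, sol (a * t) (b * t) ∧ sol (c * t) (d * t) := by
  classical
  obtain ⟨ti, hti, hi1, hi2⟩ := Hi
  obtain ⟨t2, ht2, h21, h22⟩ := H2
  have Hp' : ∀ p : ℕ, ∃ t : ℤ, t ≠ 0 ∧ (p.Prime → p ≠ 2 →
      hh p (a * t) (b * t) = 0 ∧ hh p (c * t) (d * t) = 0) := by
    intro p
    by_cases h : p.Prime ∧ p ≠ 2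
    · obtain ⟨t, h1, h2⟩ := Hp p h.1 h.2
      exact ⟨t, h1, fun _ _ => h2⟩
    · exact ⟨1, one_ne_zero, fun h1 h2 => absurd ⟨h1, h2⟩ h⟩
  choose T hT hTp using Hp'
  have hprod : a * b * c * d ≠ 0 := mul_ne_zero (mul_ne_zero (mul_ne_zero ha hb) hc) hd
  let S := (a * b * c * d).natAbs.primeFactors.erase 2
  have hS : ∀ p ∈ S, p.Prime ∧ p ≠ 2 := by
    intro p hp
    have := Finset.mem_erase.1 hp
    exact ⟨Nat.prime_of_mem_primeFactors this.2, this.1⟩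
  have hmem : ∀ p : ℕ, p.Prime → p ≠ 2 → (p : ℤ) ∣ a * b * c * d → p ∈ S := by
    intro p h1 h2 h3
    refine Finset.mem_erase.2 ⟨h2, Nat.mem_primeFactors.2 ⟨h1, Int.natCast_dvd.1 h3, by simpa using hprod⟩⟩
  obtain ⟨t, q, ht, hq, hqS, hq2, hng, hdt, happ⟩ := approx (insert 2 S) (by
    intro p hp
    rcases Finset.mem_insert.1 hp with rfl | h
    · exact Nat.prime_two
    · exact (hS p h).1) (fun p => if p = 2 then t2 else T p) (by
    intro p; split_ifs
    · exact ht2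
    · exact hT p) (if ti < 0 then -1 else 1) (by split_ifs <;> simp)
  have hngt : ng t = ng ti := by
    rw [hng]; unfold ng; split_ifs <;> first | rfl | omega
  have a2 := happ 2 (Finset.mem_insert_self _ _)
  simp only [if_true] at a2
  have a2' : uu 2 t ≡ uu 2 t2 [ZMOD 8] := a2.2
  have ap : ∀ p ∈ S, vv p t = vv p (T p) ∧ ss p t = ss p (T p) := by
    intro p hp
    have h := happ p (Finset.mem_insert_of_mem hp)
    simp only [(hS p hp).2, if_false] at h
    refine ⟨h.1, ss_congr ?_⟩
    have := h.2
    unfold mm at this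
    rwa [if_neg (hS p hp).2] at this
  have hqS0 : q ∉ S := fun h => hqS (Finset.mem_insert_of_mem h)
  have hdt' : ∀ p : ℕ, p.Prime → p ≠ 2 → (p : ℤ) ∣ t → p ∈ S ∨ p = q := by
    intro p h1 h2 h3
    rcases hdt p h1 h3 with h | h
    · rcases Finset.mem_insert.1 h with h | h
      · exact absurd h h2
      · exact Or.inl h
    · exact Or.inr h
  have hdiv : ∀ x : ℤ, x ∣ a * b * c * d → ∀ p : ℕ, p.Prime → p ≠ 2 → (p : ℤ) ∣ x * t → p ∈ S ∨ p = q := by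
    intro x hx p h1 h2 h3
    rcases (Nat.prime_iff_prime_int.1 h1).dvd_or_dvd h3 with h | h
    · exact Or.inl (hmem p h1 h2 (h.trans hx))
    · exact hdt' p h1 h2 h
  refine ⟨t, ht, ?_, ?_⟩
  · refine close_q hS hq (by omega) hqS0 (mul_ne_zero ha ht) (mul_ne_zero hb ht)
      (hdiv a ⟨b * c * d, by ring⟩) (hdiv b ⟨a * c * d, by ring⟩) ?_ ?_ ?_
    · rw [hi_congr ha hb ht hti hngt]; exact hi1
    · rw [h2_congr ha hb ht ht2 a2.1 (ep_congr a2') (om_congr a2')]; exact h21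
    · intro p hp
      rw [hh_congr (hS p hp).1 ha hb ht (hT p) (ap p hp).1 (ap p hp).2]
      exact (hTp p (hS p hp).1 (hS p hp).2).1
  · refine close_q hS hq (by omega) hqS0 (mul_ne_zero hc ht) (mul_ne_zero hd ht)
      (hdiv c ⟨a * b * d, by ring⟩) (hdiv d ⟨a * b * c, by ring⟩) ?_ ?_ ?_
    · rw [hi_congr hc hd ht hti hngt]; exact hi2
    · rw [h2_congr hc hd ht ht2 a2.1 (ep_congr a2') (om_congr a2')]; exact h22
    · intro p hp
      rw [hh_congr (hS p hp).1 hc hd ht (hT p) (ap p hp).1 (ap p hp).2]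
      exact (hTp p (hS p hp).1 (hS p hp).2).2

/-- converse -/
theorem sol_local {x y : ℤ} (hx : x ≠ 0) (hy : y ≠ 0) (h : sol x y) :
    hi x y = 0 ∧ h2 x y = 0 ∧ ∀ p : ℕ, p.Prime → hh p x y = 0 := by
  obtain ⟨z, u, v, he, hn⟩ := h
  have h1 := hi_nec he hn
  have h3 : ∀ p : ℕ, p.Prime → hh p x y = 0 := fun p hp => loc_nec hp hx hy he hn
  refine ⟨h1, ?_, h3⟩
  have hxy : x * y ≠ 0 := mul_ne_zero hx hy
  have hS : ∀ p ∈ (x * y).natAbs.primeFactors.erase 2, p.Prime ∧ p ≠ 2 := by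
    intro p hp
    have := Finset.mem_erase.1 hp
    exact ⟨Nat.prime_of_mem_primeFactors this.2, this.1⟩
  have hmem : ∀ p : ℕ, p.Prime → p ≠ 2 → (p : ℤ) ∣ x * y → p ∈ (x * y).natAbs.primeFactors.erase 2 := by
    intro p h1 h2 h3
    exact Finset.mem_erase.2 ⟨h2, Nat.mem_primeFactors.2 ⟨h1, Int.natCast_dvd.1 h3, by simpa using hxy⟩⟩
  have hF := product_formula hS hx hy (fun p a b c => hmem p a b (c.mul_right _))
    (fun p a b c => hmem p a b (c.mul_left _))
  unfold FF at hF
  rw [h1, Finset.sum_eq_zero (fun p hp => h3 p (hS p hp).1)] at hF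
  simpa using hF
/-! rational translation -/
lemma rat_of_sol {a b t : ℤ} (ha : a ≠ 0) (hb : b ≠ 0) (ht : t ≠ 0) (h : sol (a * t) (b * t)) :
    ∃ x y : ℚ, (a : ℚ) * x ^ 2 + b * y ^ 2 = t := by
  obtain ⟨z, u, v, he, hn⟩ := h
  have he' : (z : ℚ) ^ 2 = a * t * u ^ 2 + b * t * v ^ 2 := by exact_mod_cast he
  have ha' : (a : ℚ) ≠ 0 := by exact_mod_cast ha
  have hb' : (b : ℚ) ≠ 0 := by exact_mod_cast hb
  have ht' : (t : ℚ) ≠ 0 := by exact_mod_cast ht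
  by_cases hz : z = 0
  · subst hz
    have h0 : (a : ℚ) * u ^ 2 + b * v ^ 2 = 0 := by
      have : (t : ℚ) * ((a : ℚ) * u ^ 2 + b * v ^ 2) = 0 := by
        push_cast at he'; linear_combination -he'
      exact (mul_eq_zero.1 this).resolve_left ht'
    by_cases hu : u = 0
    · subst hu
      have hv : (v : ℚ) ≠ 0 := by
        intro h; apply hn; exact ⟨rfl, rfl, by exact_mod_cast h⟩
      refine ⟨0, (t - b) / (2 * b * v) * v + 1, ?_⟩
      exfalso
      apply mul_ne_zero hb' (pow_ne_zero 2 hv)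
      push_cast at h0; linear_combination h0
    · have hu : (u : ℚ) ≠ 0 := by exact_mod_cast hu
      refine ⟨(t - a) / (2 * a * u) * u + 1, (t - a) / (2 * a * u) * v, ?_⟩
      have : (a : ℚ) * ((t - a) / (2 * a * u) * u + 1) ^ 2 + b * ((t - a) / (2 * a * u) * v) ^ 2
        = ((t - a) / (2 * a * u)) ^ 2 * (a * u ^ 2 + b * v ^ 2) + 2 * ((t - a) / (2 * a * u)) * a * u + a := by ring
      rw [this, h0]; field_simp; ring
  · have hz : (z : ℚ) ≠ 0 := by exact_mod_cast hz
    refine ⟨u * t / z, v * t / z, ?_⟩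
    field_simp
    linear_combination -he'

lemma sol_of_rat {a b t : ℤ} (ht : t ≠ 0) {x y : ℚ} (h : (a : ℚ) * x ^ 2 + b * y ^ 2 = t) :
    sol (a * t) (b * t) := by
  have hx : (x.den : ℚ) ≠ 0 := by exact_mod_cast x.den_ne_zero
  have hy : (y.den : ℚ) ≠ 0 := by exact_mod_cast y.den_ne_zero
  refine ⟨t * (x.den * y.den), x.num * y.den, y.num * x.den, ?_, ?_⟩
  · have h1 : x * x.den = x.num := Rat.mul_den_eq_num x
    have h2 : y * y.den = y.num := Rat.mul_den_eq_num y
    have : ((t : ℚ) * (x.den * y.den)) ^ 2 =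
      a * t * (x.num * y.den) ^ 2 + b * t * (y.num * x.den) ^ 2 := by
      rw [← h1, ← h2]
      linear_combination -(t : ℚ) * x.den ^ 2 * y.den ^ 2 * h
    exact_mod_cast this
  · rintro ⟨h0, -, -⟩
    have h1 : (x.den : ℤ) ≠ 0 := by exact_mod_cast x.den_ne_zero
    have h2 : (y.den : ℤ) ≠ 0 := by exact_mod_cast y.den_ne_zero
    exact mul_ne_zero ht (mul_ne_zero h1 h2) h0

lemma univ3 {a b c x y z : ℚ} (ha : a ≠ 0) (hx : x ≠ 0)
    (h : a * x ^ 2 + b * y ^ 2 + c * z ^ 2 = 0) (N : ℚ) :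
    ∃ x y z : ℚ, a * x ^ 2 + b * y ^ 2 + c * z ^ 2 = N := by
  refine ⟨(N - a) / (2 * a * x) * x + 1, (N - a) / (2 * a * x) * y, (N - a) / (2 * a * x) * z, ?_⟩
  have : a * ((N - a) / (2 * a * x) * x + 1) ^ 2 + b * ((N - a) / (2 * a * x) * y) ^ 2
      + c * ((N - a) / (2 * a * x) * z) ^ 2
    = ((N - a) / (2 * a * x)) ^ 2 * (a * x ^ 2 + b * y ^ 2 + c * z ^ 2)
      + 2 * ((N - a) / (2 * a * x)) * a * x + a := by ring
  rw [this, h]; field_simp; ring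

lemma univ2 {a b x y : ℚ} (ha : a ≠ 0) (hx : x ≠ 0)
    (h : a * x ^ 2 + b * y ^ 2 = 0) (N : ℚ) :
    ∃ x y : ℚ, a * x ^ 2 + b * y ^ 2 = N := by
  obtain ⟨x, y, z, h⟩ := univ3 (b := b) (y := y) (c := 0) (z := 0) ha hx (by linear_combination h) N
  exact ⟨x, y, by linear_combination h⟩

theorem rep_iff {a b c n : ℤ} (ha : a ≠ 0) (hb : b ≠ 0) (hc : c ≠ 0) (hn : n ≠ 0) {m : ℚ} (hm : m ≠ 0) :
    (∃ x y z : ℚ, (a : ℚ) * x ^ 2 + (b : ℚ) * y ^ 2 + (c : ℚ) * z ^ 2 = n * m ^ 2) ↔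
    ∃ t : ℤ, t ≠ 0 ∧ sol (a * t) (b * t) ∧ sol (n * t) (-c * t) := by
  have ha' : (a : ℚ) ≠ 0 := by exact_mod_cast ha
  have hb' : (b : ℚ) ≠ 0 := by exact_mod_cast hb
  have hc' : (c : ℚ) ≠ 0 := by exact_mod_cast hc
  have hn' : (n : ℚ) ≠ 0 := by exact_mod_cast hn
  constructor
  · rintro ⟨x, y, z, h⟩
    obtain ⟨x, y, z, h⟩ : ∃ x y z : ℚ, (a : ℚ) * x ^ 2 + (b : ℚ) * y ^ 2 + (c : ℚ) * z ^ 2 = n :=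
      ⟨x / m, y / m, z / m, by field_simp; linear_combination h⟩
    by_cases ht : (a : ℚ) * x ^ 2 + (b : ℚ) * y ^ 2 = 0
    · by_cases hx : x = 0
      · subst hx
        have hy : y = 0 := by
          have : (b : ℚ) * y ^ 2 = 0 := by linear_combination ht
          simpa [hb'] using this
        subst hy
        obtain ⟨r, s, hrs⟩ := univ2 (b := -(c : ℚ)) (y := z) hn' one_ne_zero
          (by linear_combination -h) (a : ℚ)
        exact ⟨a, ha, sol_of_rat ha (x := 1) (y := 0) (by ring),
          sol_of_rat ha (x := r) (y := s) (by push_cast; linear_combination hrs)⟩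
      · obtain ⟨r, s, hrs⟩ := univ2 ha' hx ht (n : ℚ)
        exact ⟨n, hn, sol_of_rat hn hrs, sol_of_rat hn (x := 1) (y := 0) (by ring)⟩
    · set t' := (a : ℚ) * x ^ 2 + (b : ℚ) * y ^ 2 with ht'
      have hd : (t'.den : ℚ) ≠ 0 := by exact_mod_cast t'.den_ne_zero
      have e : t' * t'.den = t'.num := Rat.mul_den_eq_num t'
      have hT : t'.num * t'.den ≠ 0 := mul_ne_zero (Rat.num_ne_zero.2 ht) (by exact_mod_cast t'.den_ne_zero)
      refine ⟨t'.num * t'.den, hT, sol_of_rat hT (x := x * t'.den) (y := y * t'.den) ?_,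
        sol_of_rat hT (x := t'.den) (y := z * t'.den) ?_⟩
      · push_cast; rw [← e]
        linear_combination -(t'.den : ℚ) ^ 2 * ht'
      · push_cast; rw [← e]
        linear_combination -(t'.den : ℚ) ^ 2 * h
  · rintro ⟨t, ht, h1, h2⟩
    obtain ⟨x, y, h1⟩ := rat_of_sol ha hb ht h1
    obtain ⟨w, z, h2⟩ := rat_of_sol hn (neg_ne_zero.2 hc) ht h2
    push_cast at h2
    have ht' : (t : ℚ) ≠ 0 := by exact_mod_cast ht
    by_cases hw : w = 0
    · subst hw
      have h3 : (a : ℚ) * x ^ 2 + b * y ^ 2 + c * z ^ 2 = 0 := by linear_combination h1 - h2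
      by_cases hx : x = 0
      · have hy : y ≠ 0 := by
          rintro rfl; subst hx; apply ht'; linear_combination -h1
        obtain ⟨r, s, u, h⟩ := univ3 (a := b) (b := a) (c := c) (x := y) (y := x) (z := z) hb' hy
          (by linear_combination h3) (n * m ^ 2)
        exact ⟨s, r, u, by linear_combination h⟩
      · exact univ3 ha' hx h3 _
    · refine ⟨x * m / w, y * m / w, z * m / w, ?_⟩
      field_simp
      linear_combination h1 - h2

theorem main_iff {a b c n : ℤ} (ha : a ≠ 0) (hb : b ≠ 0) (hc : c ≠ 0) (hn : n ≠ 0) {m : ℚ} (hm : m ≠ 0) :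
    (∃ x y z : ℚ, (a : ℚ) * x ^ 2 + (b : ℚ) * y ^ 2 + (c : ℚ) * z ^ 2 = n * m ^ 2) ↔
    (∃ t ≠ 0, hi (a * t) (b * t) = 0 ∧ hi (n * t) (-c * t) = 0) ∧
    (∃ t ≠ 0, h2 (a * t) (b * t) = 0 ∧ h2 (n * t) (-c * t) = 0) ∧
    (∀ p : ℕ, p.Prime → p ≠ 2 → ∃ t ≠ 0, hh p (a * t) (b * t) = 0 ∧ hh p (n * t) (-c * t) = 0) := by
  rw [rep_iff ha hb hc hn hm]
  have hc' := neg_ne_zero.2 hc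
  constructor
  · rintro ⟨t, ht, h1, h2⟩
    obtain ⟨a1, a2, a3⟩ := sol_local (mul_ne_zero ha ht) (mul_ne_zero hb ht) h1
    obtain ⟨b1, b2, b3⟩ := sol_local (mul_ne_zero hn ht) (mul_ne_zero hc' ht) h2
    exact ⟨⟨t, ht, a1, b1⟩, ⟨t, ht, a2, b2⟩, fun p hp _ => ⟨t, ht, a3 p hp, b3 p hp⟩⟩
  · rintro ⟨h1, h2, h3⟩
    exact global ha hb hn hc' h1 h2 h3
/-! local computations -/
lemma dec_inf : ∀ a b c n : ZMod 2, (∃ t : ZMod 2, (a + t) * (b + t) = 0 ∧ (n + t) * (1 + c + t) = 0) ↔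
    ((a = 0 ∧ b = 0 ∧ c = 0 → n = 0) ∧ (a = 1 ∧ b = 1 ∧ c = 1 → n = 1)) := by decide

set_option synthInstance.maxHeartbeats 400000 in
set_option synthInstance.maxSize 10000 in
lemma dec_odd : ∀ Va Vb Vc : ZMod 2, ¬ (Va = 1 ∧ Vb = 1) → ¬ (Va = 1 ∧ Vc = 1) → ¬ (Vb = 1 ∧ Vc = 1) →
    ∀ E Sa Sb Sc Vn Sn : ZMod 2,
    ((∃ v s : ZMod 2, E * (Va + v) * (Vb + v) + (Sa + s) * (Vb + v) + (Sb + s) * (Va + v) = 0 ∧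
      E * (Vn + v) * (Vc + v) + (Sn + s) * (Vc + v) + (E + Sc + s) * (Vn + v) = 0) ↔
    (Vn = 1 → (Va = 1 → E + Sb + Sc = 0 ∨ Sn + Sa = 0) ∧ (Vb = 1 → E + Sa + Sc = 0 ∨ Sn + Sb = 0) ∧
      (Vc = 1 → E + Sa + Sb = 0 ∨ Sn + Sc = 0))) := by decide +kernel

def QQ (ea eb ob ec oc : ZMod 2) : Prop := (eb ≠ ec ∧ ob ≠ oc) ∨ (eb = ec ∧ ea = eb + ob + oc)
instance (ea eb ob ec oc : ZMod 2) : Decidable (QQ ea eb ob ec oc) := by unfold QQ; infer_instance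

set_option synthInstance.maxHeartbeats 400000 in
set_option synthInstance.maxSize 10000 in
lemma dec_two : ∀ Va Vb Vc : ZMod 2, ¬ (Va = 1 ∧ Vb = 1) → ¬ (Va = 1 ∧ Vc = 1) → ¬ (Vb = 1 ∧ Vc = 1) →
    ∀ ea oa eb ob ec oc Vn en on : ZMod 2,
    ((∃ v e o : ZMod 2, (ea + e) * (eb + e) + (oa + o) * (Vb + v) + (ob + o) * (Va + v) = 0 ∧
      (en + e) * (1 + ec + e) + (on + o) * (Vc + v) + (oc + o) * (Vn + v) = 0) ↔
    (Vn = Va + Vb + Vc ∧ en = 1 + (ea + eb + ec) ∧ on = oa + ob + oc →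
      ¬ (Va = 0 ∧ Vb = 0 ∧ Vc = 0 ∧ ea = eb ∧ eb = ec) ∧
      ¬ (Va = 1 ∧ QQ ea eb ob ec oc) ∧ ¬ (Vb = 1 ∧ QQ eb ea oa ec oc) ∧
      ¬ (Vc = 1 ∧ QQ ec ea oa eb ob))) := by decide +kernel
lemma z2 (x : ZMod 2) : x = 0 ∨ x = 1 := by revert x; decide

lemma ng0 {x : ℤ} (hx : x ≠ 0) : ng x = 0 ↔ 0 < x := by
  unfold ng; split_ifs with h
  · exact iff_of_false (by decide) (by omega)
  · exact iff_of_true rfl (by omega)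
lemma ng1 {x : ℤ} : ng x = 1 ↔ x < 0 := by
  unfold ng; split_ifs with h
  · exact iff_of_true rfl h
  · exact iff_of_false (by decide) h

lemma ng_negc {c : ℤ} (hc : c ≠ 0) : ng (-c) = 1 + ng c := by
  rw [neg_eq_neg_one_mul, ng_mul (by norm_num) hc, ng_neg]

lemma loc_inf {a b c n : ℤ} (ha : a ≠ 0) (hb : b ≠ 0) (hc : c ≠ 0) (hn : n ≠ 0) :
    (∃ t ≠ 0, hi (a * t) (b * t) = 0 ∧ hi (n * t) (-c * t) = 0) ↔
    ((0 < a ∧ 0 < b ∧ 0 < c → 0 < n) ∧ (a < 0 ∧ b < 0 ∧ c < 0 → n < 0)) := by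
  have hc' := neg_ne_zero.2 hc
  have := dec_inf (ng a) (ng b) (ng c) (ng n)
  rw [ng0 ha, ng0 hb, ng0 hc, ng0 hn, ng1, ng1, ng1, ng1] at this
  rw [← this]
  unfold hi
  constructor
  · rintro ⟨t, ht, h1, h2⟩
    rw [ng_mul ha ht, ng_mul hb ht] at h1
    rw [ng_mul hn ht, ng_mul hc' ht, ng_negc hc] at h2
    exact ⟨ng t, h1, h2⟩
  · rintro ⟨s, h1, h2⟩
    obtain ⟨t, ht, hs⟩ : ∃ t : ℤ, t ≠ 0 ∧ ng t = s := by
      rcases z2 s with rfl | rfl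
      · exact ⟨1, by norm_num, by decide⟩
      · exact ⟨-1, by norm_num, by decide⟩
    subst hs
    refine ⟨t, ht, ?_, ?_⟩
    · rw [ng_mul ha ht, ng_mul hb ht]; exact h1
    · rw [ng_mul hn ht, ng_mul hc' ht, ng_negc hc]; exact h2

lemma vv_negc {p : ℕ} (hp : p.Prime) {c : ℤ} (hc : c ≠ 0) : vv p (-c) = vv p c := by
  rw [neg_eq_neg_one_mul, vv_mul hp (by norm_num) hc, vv_unit hp (not_dvd_neg_one hp), zero_add]
lemma ss_negc {p : ℕ} (hp : p.Prime) {c : ℤ} (hc : c ≠ 0) : ss p (-c) = ss p (-1) + ss p c := by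
  rw [neg_eq_neg_one_mul, ss_mul hp (by norm_num) hc]

lemma vv_iff {p : ℕ} (hp : p.Prime) {x : ℤ} (hx : Squarefree x) : vv p x = 1 ↔ (p : ℤ) ∣ x := by
  by_cases h : (p : ℤ) ∣ x
  · exact iff_of_true (vv_one_of_sqf hp hx h).1 h
  · rw [vv_unit hp h]; exact iff_of_false (by decide) h

lemma jac1 {p : ℕ} (hp : p.Prime) {b c : ℤ} (hb : ¬ (p : ℤ) ∣ b) (hc : ¬ (p : ℤ) ∣ c) :
    jacobiSym (-b * c) p = 1 ↔ ss p (-1) + ss p b + ss p c = 0 := by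
  have hb0 : b ≠ 0 := by rintro rfl; exact hb (dvd_zero _)
  have hc0 : c ≠ 0 := by rintro rfl; exact hc (dvd_zero _)
  have hbc : ¬ (p : ℤ) ∣ -b * c := by
    intro h
    rcases (Nat.prime_iff_prime_int.1 hp).dvd_or_dvd h with h | h
    · exact hb ((dvd_neg).1 h)
    · exact hc h
  rw [← ss_negc hp hb0, ← ss_mul hp (neg_ne_zero.2 hb0) hc0, ss_unit hp hbc, sg_inj (jac_pm hp hbc)]

lemma jac2 {p : ℕ} (hp : p.Prime) {n a : ℤ} (hsn : Squarefree n) (hsa : Squarefree a)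
    (hn : (p : ℤ) ∣ n) (ha : (p : ℤ) ∣ a) :
    jacobiSym ((n / (p : ℤ)) * (a / (p : ℤ))) p = 1 ↔ ss p n + ss p a = 0 := by
  rw [← ss_mul hp hsn.ne_zero hsa.ne_zero]
  have h1 := uu_spec hp (mul_ne_zero hsn.ne_zero hsa.ne_zero)
  unfold ss
  rw [sg_inj (jac_pm hp h1.2), (vu_mul hp hsn.ne_zero hsa.ne_zero).2,
    (vv_one_of_sqf hp hsn hn).2, (vv_one_of_sqf hp hsa ha).2]

lemma cop_not {p : ℕ} (hp : p.Prime) {a b : ℤ} (hab : IsCoprime a b) (ha : (p : ℤ) ∣ a) : ¬ (p : ℤ) ∣ b :=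
  fun hb => (Nat.prime_iff_prime_int.1 hp).not_isUnit (hab.isUnit_of_dvd' ha hb)

lemma ex_cls {p : ℕ} (hp : p.Prime) (h2 : p ≠ 2) (v s : ZMod 2) :
    ∃ t : ℤ, t ≠ 0 ∧ vv p t = v ∧ ss p t = s := by
  have := Fact.mk hp
  obtain ⟨u, hu0, hu⟩ : ∃ u : ℤ, u ≠ 0 ∧ vv p u = 0 ∧ ss p u = s := by
    rcases z2 s with rfl | rfl
    · refine ⟨1, by norm_num, ?_, ?_⟩
      · simpa using vv_sq hp (x := 1) one_ne_zero
      · simpa using ss_sq hp (x := 1) one_ne_zero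
    · obtain ⟨r, hr⟩ := FiniteField.exists_nonsquare (F := ZMod p) (by
        rw [ZMod.ringChar_zmod_n]; exact h2)
      obtain ⟨u, rfl⟩ := ZMod.intCast_surjective r
      have hnd : ¬ (p : ℤ) ∣ u := by
        intro h
        rw [← ZMod.intCast_zmod_eq_zero_iff_dvd] at h
        rw [h] at hr; exact hr (IsSquare.zero)
      refine ⟨u, by rintro rfl; exact hnd (dvd_zero _), vv_unit hp hnd, ?_⟩
      rw [ss_unit hp hnd]
      rcases jac_pm hp hnd with h | h
      · exfalso
        rw [← jacobiSym.legendreSym.to_jacobiSym, legendreSym.eq_one_iff] at h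
        · exact hr h
        · rwa [Ne, ZMod.intCast_zmod_eq_zero_iff_dvd]
      · rw [h]; rfl
  rcases z2 v with rfl | rfl
  · exact ⟨u, hu0, hu⟩
  · have hp0 : (p : ℤ) ≠ 0 := by exact_mod_cast hp.ne_zero
    refine ⟨p * u, mul_ne_zero hp0 hu0, ?_, ?_⟩
    · rw [vv_mul hp hp0 hu0, vv_self hp, hu.1, add_zero]
    · rw [ss_mul hp hp0 hu0, ss_self hp, hu.2, zero_add]

lemma loc_odd {p : ℕ} (hp : p.Prime) (hp2 : p ≠ 2) {a b c n : ℤ}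
    (hsa : Squarefree a) (hsb : Squarefree b) (hsc : Squarefree c) (hsn : Squarefree n)
    (hab : IsCoprime a b) (hac : IsCoprime a c) (hbc : IsCoprime b c) :
    (∃ t ≠ 0, hh p (a * t) (b * t) = 0 ∧ hh p (n * t) (-c * t) = 0) ↔
    ((p : ℤ) ∣ n →
         (((p : ℤ) ∣ a → (jacobiSym (-b * c) p = 1 ∨
            jacobiSym ((n / (p : ℤ)) * (a / (p : ℤ))) p = 1)) ∧
          ((p : ℤ) ∣ b → (jacobiSym (-a * c) p = 1 ∨
            jacobiSym ((n / (p : ℤ)) * (b / (p : ℤ))) p = 1)) ∧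
          ((p : ℤ) ∣ c → (jacobiSym (-a * b) p = 1 ∨
            jacobiSym ((n / (p : ℤ)) * (c / (p : ℤ))) p = 1)))) := by
  have ha := hsa.ne_zero
  have hb := hsb.ne_zero
  have hc := hsc.ne_zero
  have hn := hsn.ne_zero
  have hc' := neg_ne_zero.2 hc
  have key := dec_odd (vv p a) (vv p b) (vv p c)
    (by rw [vv_iff hp hsa, vv_iff hp hsb]; exact fun h => cop_not hp hab h.1 h.2)
    (by rw [vv_iff hp hsa, vv_iff hp hsc]; exact fun h => cop_not hp hac h.1 h.2)
    (by rw [vv_iff hp hsb, vv_iff hp hsc]; exact fun h => cop_not hp hbc h.1 h.2)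
    (ss p (-1)) (ss p a) (ss p b) (ss p c) (vv p n) (ss p n)
  rw [vv_iff hp hsa, vv_iff hp hsb, vv_iff hp hsc, vv_iff hp hsn] at key
  have lhs : (∃ t ≠ 0, hh p (a * t) (b * t) = 0 ∧ hh p (n * t) (-c * t) = 0) ↔
    (∃ v s : ZMod 2, ss p (-1) * (vv p a + v) * (vv p b + v) + (ss p a + s) * (vv p b + v) + (ss p b + s) * (vv p a + v) = 0 ∧
      ss p (-1) * (vv p n + v) * (vv p c + v) + (ss p n + s) * (vv p c + v) + (ss p (-1) + ss p c + s) * (vv p n + v) = 0) := by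
    unfold hh
    constructor
    · rintro ⟨t, ht, h1, h2⟩
      refine ⟨vv p t, ss p t, ?_, ?_⟩
      · rw [← h1, vv_mul hp ha ht, vv_mul hp hb ht, ss_mul hp ha ht, ss_mul hp hb ht]
      · rw [← h2, vv_mul hp hn ht, vv_mul hp hc' ht, ss_mul hp hn ht, ss_mul hp hc' ht,
          vv_negc hp hc, ss_negc hp hc]
    · rintro ⟨v, s, h1, h2⟩
      obtain ⟨t, ht, rfl, rfl⟩ := ex_cls hp hp2 v s
      refine ⟨t, ht, ?_, ?_⟩
      · rw [vv_mul hp ha ht, vv_mul hp hb ht, ss_mul hp ha ht, ss_mul hp hb ht]; exact h1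
      · rw [vv_mul hp hn ht, vv_mul hp hc' ht, ss_mul hp hn ht, ss_mul hp hc' ht,
          vv_negc hp hc, ss_negc hp hc]; exact h2
  rw [lhs, key]
  refine imp_congr_right fun hpn => and_congr (imp_congr_right fun h => ?_)
    (and_congr (imp_congr_right fun h => ?_) (imp_congr_right fun h => ?_))
  · rw [jac1 hp (cop_not hp hab h) (cop_not hp hac h), jac2 hp hsn hsa hpn h]
  · rw [jac1 hp (cop_not hp hab.symm h) (cop_not hp hbc h), jac2 hp hsn hsb hpn h]
  · rw [jac1 hp (cop_not hp hac.symm h) (cop_not hp hbc.symm h), jac2 hp hsn hsc hpn h]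
lemma val8 {x : ℤ} (h : ¬ (2 : ℤ) ∣ x) : (x % 8 = 1 ∧ ep x = 0 ∧ om x = 0) ∨
    (x % 8 = 3 ∧ ep x = 1 ∧ om x = 1) ∨ (x % 8 = 5 ∧ ep x = 0 ∧ om x = 1) ∨
    (x % 8 = 7 ∧ ep x = 1 ∧ om x = 0) := by
  rw [ep_odd h, om_odd h, ZMod.χ₄_int_eq_if_mod_four, ZMod.χ₈_int_eq_if_mod_eight]
  have h2 : x % 2 ≠ 0 := by omega
  rcases (by omega : x % 8 = 1 ∨ x % 8 = 3 ∨ x % 8 = 5 ∨ x % 8 = 7) with h8 | h8 | h8 | h8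
  · have h4 : x % 4 = 1 := by omega
    simp only [h2, h4, h8]; decide
  · have h4 : x % 4 = 3 := by omega
    simp only [h2, h4, h8]; decide
  · have h4 : x % 4 = 1 := by omega
    simp only [h2, h4, h8]; decide
  · have h4 : x % 4 = 3 := by omega
    simp only [h2, h4, h8]; decide

lemma ep_iff {x y : ℤ} (hx : ¬ (2 : ℤ) ∣ x) (hy : ¬ (2 : ℤ) ∣ y) : ep x = ep y ↔ x ≡ y [ZMOD 4] := by
  unfold Int.ModEq
  rcases val8 hx with ⟨h1, h2, -⟩ | ⟨h1, h2, -⟩ | ⟨h1, h2, -⟩ | ⟨h1, h2, -⟩ <;>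
  rcases val8 hy with ⟨h3, h4, -⟩ | ⟨h3, h4, -⟩ | ⟨h3, h4, -⟩ | ⟨h3, h4, -⟩ <;>
  rw [h2, h4] <;>
  first
  | exact iff_of_true (by decide) (by omega)
  | exact iff_of_false (by decide) (by omega)

lemma epom_iff {x y : ℤ} (hx : ¬ (2 : ℤ) ∣ x) (hy : ¬ (2 : ℤ) ∣ y) :
    (ep x = ep y ∧ om x = om y) ↔ x ≡ y [ZMOD 8] := by
  unfold Int.ModEq
  rcases val8 hx with ⟨h1, h2, h5⟩ | ⟨h1, h2, h5⟩ | ⟨h1, h2, h5⟩ | ⟨h1, h2, h5⟩ <;>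
  rcases val8 hy with ⟨h3, h4, h6⟩ | ⟨h3, h4, h6⟩ | ⟨h3, h4, h6⟩ | ⟨h3, h4, h6⟩ <;>
  rw [h2, h4, h5, h6] <;>
  first
  | exact iff_of_true (by decide) (by omega)
  | exact iff_of_false (by decide) (by omega)

lemma vv2_iff {x : ℤ} (hx : Squarefree x) : vv 2 x = 1 ↔ (2 : ℤ) ∣ x := vv_iff Nat.prime_two hx

lemma two_mul_cls {u : ℤ} (hu : ¬ (2 : ℤ) ∣ u) :
    vv 2 (2 * u) = 1 ∧ ep (2 * u) = ep u ∧ om (2 * u) = om u := by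
  have hu0 : u ≠ 0 := by rintro rfl; exact hu (dvd_zero _)
  rw [vv_mul Nat.prime_two (by norm_num) hu0, ep_mul (by norm_num) hu0, om_mul (by norm_num) hu0,
    vv2_two, ep_two, om_two, vv2_odd hu]
  simp

lemma sqf_half {x : ℤ} (hx : Squarefree x) (h : (2 : ℤ) ∣ x) : ∃ u : ℤ, x = 2 * u ∧ ¬ (2 : ℤ) ∣ u := by
  obtain ⟨u, rfl⟩ := h
  refine ⟨u, rfl, ?_⟩
  rintro ⟨k, rfl⟩
  have := hx 2 ⟨k, by ring⟩
  revert this; decide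

lemma cls_odd {n X : ℤ} (hn : Squarefree n) (hX : ¬ (2 : ℤ) ∣ X) :
    (vv 2 n = vv 2 X ∧ ep n = ep X ∧ om n = om X) ↔ n ≡ X [ZMOD 8] := by
  rw [vv2_odd hX]
  by_cases h : (2 : ℤ) ∣ n
  · rw [(vv2_iff hn).2 h]
    refine iff_of_false (fun h => absurd h.1 (by decide)) (fun h' => ?_)
    unfold Int.ModEq at h'; omega
  · rw [vv2_odd h, ← epom_iff h hX]; simp

lemma cls_even {n Y : ℤ} (hn : Squarefree n) (hY : ¬ (2 : ℤ) ∣ Y) :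
    (vv 2 n = vv 2 (2 * Y) ∧ ep n = ep (2 * Y) ∧ om n = om (2 * Y)) ↔ n ≡ 2 * Y [ZMOD 16] := by
  rw [(two_mul_cls hY).1, (two_mul_cls hY).2.1, (two_mul_cls hY).2.2, vv2_iff hn]
  by_cases h : (2 : ℤ) ∣ n
  · obtain ⟨u, rfl, hu⟩ := sqf_half hn h
    rw [(two_mul_cls hu).2.1, (two_mul_cls hu).2.2, epom_iff hu hY]
    unfold Int.ModEq
    constructor
    · rintro ⟨-, h⟩; omega
    · intro h'; exact ⟨h, by omega⟩
  · refine iff_of_false (fun h' => h h'.1) (fun h' => ?_)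
    unfold Int.ModEq at h'; omega

lemma QQ_iff {u b c : ℤ} (hu : ¬ (2 : ℤ) ∣ u) (hb : ¬ (2 : ℤ) ∣ b) (hc : ¬ (2 : ℤ) ∣ c) :
    QQ (ep u) (ep b) (om b) (ep c) (om c) ↔
      (b + c ≡ 2 * u [ZMOD 8] ∨ b + c ≡ 2 * (2 * u) [ZMOD 8]) := by
  unfold Int.ModEq
  rcases val8 hu with ⟨h1, h2, -⟩ | ⟨h1, h2, -⟩ | ⟨h1, h2, -⟩ | ⟨h1, h2, -⟩ <;>
  rcases val8 hb with ⟨h3, h4, h6⟩ | ⟨h3, h4, h6⟩ | ⟨h3, h4, h6⟩ | ⟨h3, h4, h6⟩ <;>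
  rcases val8 hc with ⟨h7, h8, h9⟩ | ⟨h7, h8, h9⟩ | ⟨h7, h8, h9⟩ | ⟨h7, h8, h9⟩ <;>
  rw [h2, h4, h6, h8, h9] <;>
  first
  | exact iff_of_true (by decide) (by omega)
  | exact iff_of_false (by decide) (by omega)

lemma odd_iff' {x : ℤ} : Odd x ↔ ¬ (2 : ℤ) ∣ x := by
  rw [← Int.not_even_iff_odd, even_iff_two_dvd]

lemma vv2_zero {x : ℤ} (hx : Squarefree x) : vv 2 x = 0 ↔ Odd x := by
  rw [odd_iff', ← vv2_iff hx]
  generalize vv 2 x = v; revert v; decide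

lemma cop_two {a b : ℤ} (hab : IsCoprime a b) (ha : (2 : ℤ) ∣ a) : ¬ (2 : ℤ) ∣ b :=
  cop_not Nat.prime_two hab ha

lemma not_two_mul {a b : ℤ} (ha : ¬ (2 : ℤ) ∣ a) (hb : ¬ (2 : ℤ) ∣ b) : ¬ (2 : ℤ) ∣ a * b :=
  fun h => (Int.prime_two.dvd_or_dvd h).elim ha hb

lemma even_case {a b c n X : ℤ} (hsa : Squarefree a) (hsn : Squarefree n)
    (hab : IsCoprime a b) (hac : IsCoprime a c) (hX : X = -(a * b * c)) :
    ((vv 2 n = vv 2 X ∧ ep n = ep X ∧ om n = om X) ∧ (vv 2 a = 1 ∧ QQ (ep a) (ep b) (om b) (ep c) (om c))) ↔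
    ((Even a ∧ Odd b ∧ Odd c ∧ (b + c ≡ a [ZMOD 8] ∨ b + c ≡ 2 * a [ZMOD 8])) ∧ n ≡ X [ZMOD 16]) := by
  rw [vv2_iff hsa, even_iff_two_dvd]
  by_cases h : (2 : ℤ) ∣ a
  · have hb := cop_two hab h
    have hc := cop_two hac h
    obtain ⟨u, rfl, hu⟩ := sqf_half hsa h
    have hY : ¬ (2 : ℤ) ∣ -(u * b * c) := by
      rw [dvd_neg]; exact not_two_mul (not_two_mul hu hb) hc
    have e : X = 2 * -(u * b * c) := by rw [hX]; ring
    rw [e, cls_even hsn hY, (two_mul_cls hu).2.1, QQ_iff hu hb hc, odd_iff', odd_iff']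
    tauto
  · tauto

lemma ex_cls2 (v e o : ZMod 2) : ∃ t : ℤ, t ≠ 0 ∧ vv 2 t = v ∧ ep t = e ∧ om t = o := by
  obtain ⟨u, hu, h1, h2⟩ : ∃ u : ℤ, ¬ (2 : ℤ) ∣ u ∧ ep u = e ∧ om u = o := by
    rcases z2 e with rfl | rfl <;> rcases z2 o with rfl | rfl
    · refine ⟨1, by norm_num, ?_⟩
      have := val8 (x := 1) (by norm_num); norm_num at this; exact this
    · refine ⟨5, by norm_num, ?_⟩
      have := val8 (x := 5) (by norm_num); norm_num at this; exact this
    · refine ⟨7, by norm_num, ?_⟩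
      have := val8 (x := 7) (by norm_num); norm_num at this; exact this
    · refine ⟨3, by norm_num, ?_⟩
      have := val8 (x := 3) (by norm_num); norm_num at this; exact this
  have hu0 : u ≠ 0 := by rintro rfl; exact hu (dvd_zero _)
  rcases z2 v with rfl | rfl
  · exact ⟨u, hu0, vv2_odd hu, h1, h2⟩
  · obtain ⟨a1, a2, a3⟩ := two_mul_cls hu
    exact ⟨2 * u, mul_ne_zero two_ne_zero hu0, a1, a2.trans h1, a3.trans h2⟩

lemma ep_negc {c : ℤ} (hc : c ≠ 0) : ep (-c) = 1 + ep c := by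
  rw [neg_eq_neg_one_mul, ep_mul (by norm_num) hc, ep_neg]
lemma om_negc {c : ℤ} (hc : c ≠ 0) : om (-c) = om c := by
  rw [neg_eq_neg_one_mul, om_mul (by norm_num) hc, om_neg, zero_add]

lemma odd_case {a b c n : ℤ} (hsa : Squarefree a) (hsb : Squarefree b) (hsc : Squarefree c)
    (hsn : Squarefree n) :
    ((vv 2 n = vv 2 (-(a * b * c)) ∧ ep n = ep (-(a * b * c)) ∧ om n = om (-(a * b * c))) ∧
      (vv 2 a = 0 ∧ vv 2 b = 0 ∧ vv 2 c = 0 ∧ ep a = ep b ∧ ep b = ep c)) ↔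
      ((Odd a ∧ Odd b ∧ Odd c ∧ a ≡ b [ZMOD 4] ∧ b ≡ c [ZMOD 4]) ∧ n ≡ -(a * b * c) [ZMOD 8]) := by
  rw [vv2_zero hsa, vv2_zero hsb, vv2_zero hsc]
  by_cases h : Odd a ∧ Odd b ∧ Odd c
  · have h1 := odd_iff'.1 h.1
    have h2 := odd_iff'.1 h.2.1
    have h3 := odd_iff'.1 h.2.2
    rw [cls_odd hsn (by rw [dvd_neg]; exact not_two_mul (not_two_mul h1 h2) h3), ep_iff h1 h2, ep_iff h2 h3]
    exact and_comm
  · exact ⟨fun hh => absurd ⟨hh.2.1, hh.2.2.1, hh.2.2.2.1⟩ h,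
      fun hh => absurd ⟨hh.1.1, hh.1.2.1, hh.1.2.2.1⟩ h⟩

lemma loc_two {a b c n : ℤ}
    (hsa : Squarefree a) (hsb : Squarefree b) (hsc : Squarefree c) (hsn : Squarefree n)
    (hab : IsCoprime a b) (hac : IsCoprime a c) (hbc : IsCoprime b c) :
    (∃ t ≠ 0, h2 (a * t) (b * t) = 0 ∧ h2 (n * t) (-c * t) = 0) ↔
      (((Odd a ∧ Odd b ∧ Odd c ∧ a ≡ b [ZMOD 4] ∧ b ≡ c [ZMOD 4]) →
         ¬ n ≡ -(a * b * c) [ZMOD 8]) ∧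
       ((Even a ∧ Odd b ∧ Odd c ∧ (b + c ≡ a [ZMOD 8] ∨ b + c ≡ 2 * a [ZMOD 8])) →
         ¬ n ≡ -(a * b * c) [ZMOD 16]) ∧
       ((Odd a ∧ Even b ∧ Odd c ∧ (a + c ≡ b [ZMOD 8] ∨ a + c ≡ 2 * b [ZMOD 8])) →
         ¬ n ≡ -(a * b * c) [ZMOD 16]) ∧
       ((Odd a ∧ Odd b ∧ Even c ∧ (a + b ≡ c [ZMOD 8] ∨ a + b ≡ 2 * c [ZMOD 8])) →
         ¬ n ≡ -(a * b * c) [ZMOD 16])) := by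
  have ha := hsa.ne_zero
  have hb := hsb.ne_zero
  have hc := hsc.ne_zero
  have hn := hsn.ne_zero
  have hc' := neg_ne_zero.2 hc
  have p2 := Nat.prime_two
  have key := dec_two (vv 2 a) (vv 2 b) (vv 2 c)
    (by rw [vv2_iff hsa, vv2_iff hsb]; exact fun h => cop_two hab h.1 h.2)
    (by rw [vv2_iff hsa, vv2_iff hsc]; exact fun h => cop_two hac h.1 h.2)
    (by rw [vv2_iff hsb, vv2_iff hsc]; exact fun h => cop_two hbc h.1 h.2)
    (ep a) (om a) (ep b) (om b) (ep c) (om c) (vv 2 n) (ep n) (om n)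
  have lhs : (∃ t ≠ 0, h2 (a * t) (b * t) = 0 ∧ h2 (n * t) (-c * t) = 0) ↔
    (∃ v e o : ZMod 2, (ep a + e) * (ep b + e) + (om a + o) * (vv 2 b + v) + (om b + o) * (vv 2 a + v) = 0 ∧
      (ep n + e) * (1 + ep c + e) + (om n + o) * (vv 2 c + v) + (om c + o) * (vv 2 n + v) = 0) := by
    unfold h2
    constructor
    · rintro ⟨t, ht, h1, h2⟩
      refine ⟨vv 2 t, ep t, om t, ?_, ?_⟩
      · rw [← h1, vv_mul p2 ha ht, vv_mul p2 hb ht, ep_mul ha ht, ep_mul hb ht, om_mul ha ht, om_mul hb ht]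
      · rw [← h2, vv_mul p2 hn ht, vv_mul p2 hc' ht, ep_mul hn ht, ep_mul hc' ht, om_mul hn ht,
          om_mul hc' ht, vv_negc p2 hc, ep_negc hc, om_negc hc]
    · rintro ⟨v, e, o, h1, h2⟩
      obtain ⟨t, ht, rfl, rfl, rfl⟩ := ex_cls2 v e o
      refine ⟨t, ht, ?_, ?_⟩
      · rw [vv_mul p2 ha ht, vv_mul p2 hb ht, ep_mul ha ht, ep_mul hb ht, om_mul ha ht, om_mul hb ht]
        exact h1
      · rw [vv_mul p2 hn ht, vv_mul p2 hc' ht, ep_mul hn ht, ep_mul hc' ht, om_mul hn ht,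
          om_mul hc' ht, vv_negc p2 hc, ep_negc hc, om_negc hc]
        exact h2
  rw [lhs, key]
  have hab0 := mul_ne_zero ha hb
  have habc0 := mul_ne_zero hab0 hc
  have e1 : vv 2 a + vv 2 b + vv 2 c = vv 2 (-(a * b * c)) := by
    rw [vv_negc p2 habc0, vv_mul p2 hab0 hc, vv_mul p2 ha hb]
  have e2 : 1 + (ep a + ep b + ep c) = ep (-(a * b * c)) := by
    rw [ep_negc habc0, ep_mul hab0 hc, ep_mul ha hb]
  have e3 : om a + om b + om c = om (-(a * b * c)) := by
    rw [om_negc habc0, om_mul hab0 hc, om_mul ha hb]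
  rw [e1, e2, e3]
  have k1 := even_case (n := n) hsa hsn hab hac (X := -(a * b * c)) rfl
  have k2 := even_case (n := n) hsb hsn hab.symm hbc (X := -(a * b * c)) (by ring)
  have k3 := even_case (n := n) hsc hsn hac.symm hbc.symm (X := -(a * b * c)) (by ring)
  have k0 := odd_case hsa hsb hsc hsn
  constructor
  · intro h
    refine ⟨fun hP hX => ?_, fun hP hX => ?_, fun hP hX => ?_, fun hP hX => ?_⟩
    · have := k0.2 ⟨hP, hX⟩; exact (h this.1).1 this.2
    · have := k1.2 ⟨hP, hX⟩; exact (h this.1).2.1 this.2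
    · have := k2.2 ⟨⟨hP.2.1, hP.1, hP.2.2⟩, hX⟩; exact (h this.1).2.2.1 this.2
    · have := k3.2 ⟨⟨hP.2.2.1, hP.1, hP.2.1, hP.2.2.2⟩, hX⟩; exact (h this.1).2.2.2 this.2
  · rintro ⟨g0, g1, g2, g3⟩ hC
    refine ⟨fun hP => ?_, fun hP => ?_, fun hP => ?_, fun hP => ?_⟩
    · have := k0.1 ⟨hC, hP⟩; exact g0 this.1 this.2
    · have := k1.1 ⟨hC, hP⟩; exact g1 this.1 this.2
    · have := k2.1 ⟨hC, hP⟩; exact g2 ⟨this.1.2.1, this.1.1, this.1.2.2⟩ this.2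
    · have := k3.1 ⟨hC, hP⟩; exact g3 ⟨this.1.2.1, this.1.2.2.1, this.1.1, this.1.2.2.2⟩ this.2

end QF

theorem stmt13 (a b c : ℤ) (ha : a ≠ 0) (hb : b ≠ 0) (hc : c ≠ 0)
    (hsa : Squarefree a) (hsb : Squarefree b) (hsc : Squarefree c)
    (hab : IsCoprime a b) (hac : IsCoprime a c) (hbc : IsCoprime b c)
    (N : ℚ) (hN : N ≠ 0) (n : ℤ) (hn : Squarefree n) (m : ℚ) (hNnm : N = (n : ℚ) * m ^ 2) :
    (∃ x y z : ℚ, (a : ℚ) * x ^ 2 + (b : ℚ) * y ^ 2 + (c : ℚ) * z ^ 2 = N) ↔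
      (((0 < a ∧ 0 < b ∧ 0 < c) → 0 < N) ∧
       ((a < 0 ∧ b < 0 ∧ c < 0) → N < 0) ∧
       ((Odd a ∧ Odd b ∧ Odd c ∧ a ≡ b [ZMOD 4] ∧ b ≡ c [ZMOD 4]) →
         ¬ n ≡ -(a * b * c) [ZMOD 8]) ∧
       ((Even a ∧ Odd b ∧ Odd c ∧ (b + c ≡ a [ZMOD 8] ∨ b + c ≡ 2 * a [ZMOD 8])) →
         ¬ n ≡ -(a * b * c) [ZMOD 16]) ∧
       ((Odd a ∧ Even b ∧ Odd c ∧ (a + c ≡ b [ZMOD 8] ∨ a + c ≡ 2 * b [ZMOD 8])) →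
         ¬ n ≡ -(a * b * c) [ZMOD 16]) ∧
       ((Odd a ∧ Odd b ∧ Even c ∧ (a + b ≡ c [ZMOD 8] ∨ a + b ≡ 2 * c [ZMOD 8])) →
         ¬ n ≡ -(a * b * c) [ZMOD 16]) ∧
       (∀ p : ℕ, p.Prime → p ≠ 2 → (p : ℤ) ∣ n →
         (((p : ℤ) ∣ a → (jacobiSym (-b * c) p = 1 ∨
            jacobiSym ((n / (p : ℤ)) * (a / (p : ℤ))) p = 1)) ∧
          ((p : ℤ) ∣ b → (jacobiSym (-a * c) p = 1 ∨
            jacobiSym ((n / (p : ℤ)) * (b / (p : ℤ))) p = 1)) ∧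
          ((p : ℤ) ∣ c → (jacobiSym (-a * b) p = 1 ∨
            jacobiSym ((n / (p : ℤ)) * (c / (p : ℤ))) p = 1))))) := by
  have hm : m ≠ 0 := by
    rintro rfl; apply hN; rw [hNnm]; ring
  have hn0 := hn.ne_zero
  have hm2 : 0 < m ^ 2 := by positivity
  have hpos : 0 < N ↔ 0 < n := by
    rw [hNnm, mul_pos_iff_of_pos_right hm2]; exact_mod_cast Iff.rfl
  have hneg : N < 0 ↔ n < 0 := by
    rw [hNnm]
    constructor
    · intro h
      by_contra hc0
      have h0 : (0 : ℚ) ≤ n := by exact_mod_cast not_lt.1 hc0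
      exact absurd h (mul_nonneg h0 hm2.le).not_gt
    · intro h
      exact mul_neg_of_neg_of_pos (by exact_mod_cast h) hm2
  rw [hpos, hneg, hNnm, QF.main_iff ha hb hc hn0 hm, QF.loc_inf ha hb hc hn0,
    QF.loc_two hsa hsb hsc hn hab hac hbc]
  have hodd := fun (p : ℕ) (hp : p.Prime) (h2 : p ≠ 2) =>
    QF.loc_odd hp h2 hsa hsb hsc hn hab hac hbc
  constructor
  · rintro ⟨⟨a1, a2⟩, ⟨b1, b2, b3, b4⟩, h⟩
    exact ⟨a1, a2, b1, b2, b3, b4, fun p hp h2 => (hodd p hp h2).1 (h p hp h2)⟩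
  · rintro ⟨a1, a2, b1, b2, b3, b4, h⟩
    exact ⟨⟨a1, a2⟩, ⟨b1, b2, b3, b4⟩, fun p hp h2 => (hodd p hp h2).2 (h p hp h2)⟩
end

section
/- Suppose the product abc is square-free. Then the form ax² + by² + cz² represents every integer over the integers (i.e., for every integer n there exist integers x, y, z with ax² + by² + cz² = n) if and only if it represents zero non-trivially, i.e., there exist integers x, y, z, not all zero, with ax² + by² + cz² = 0. -/
theorem aux_conv (a b c x y z : ℤ) (hb : b ≠ 0) (hc : c ≠ 0)
    (h : a * x ^ 2 + b * y ^ 2 + c * z ^ 2 = -(a * b * c)) :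
    ∃ x y z : ℤ, ¬ (x = 0 ∧ y = 0 ∧ z = 0) ∧ a * x ^ 2 + b * y ^ 2 + c * z ^ 2 = 0 := by
  by_cases h0 : z ^ 2 + a * b = 0
  · by_cases hxy : x = 0 ∧ y = 0
    · refine ⟨b, z, 0, fun hh => hb hh.1, ?_⟩
      linear_combination b * h0
    · refine ⟨x, y, 0, fun hh => hxy ⟨hh.1, hh.2.1⟩, ?_⟩
      linear_combination h - c * h0
  · refine ⟨x * z + b * y, y * z - a * x, z ^ 2 + a * b, fun hh => h0 hh.2.2, ?_⟩
    linear_combination (z ^ 2 + a * b) * h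

theorem aux_dvd (p a b c x y z : ℤ) (hp : Prime p) (ha : ¬ p ∣ a) (hb : ¬ p ∣ b)
    (hc : ¬ p * p ∣ c) (h : a * x ^ 2 + b * y ^ 2 + c * z ^ 2 = 0)
    (h1 : p ∣ a * x) (h2 : p ∣ b * y) : p ∣ x ∧ p ∣ y ∧ p ∣ z := by
  have hx := (hp.dvd_or_dvd h1).resolve_left ha
  have hy := (hp.dvd_or_dvd h2).resolve_left hb
  refine ⟨hx, hy, ?_⟩
  by_contra hz
  obtain ⟨x, rfl⟩ := hx
  obtain ⟨y, rfl⟩ := hy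
  have hd : p * p ∣ c * z ^ 2 := ⟨-(a * x ^ 2 + b * y ^ 2), by linear_combination h⟩
  have hcop : IsCoprime p z := (hp.irreducible.coprime_iff_not_dvd).2 hz
  exact hc ((IsCoprime.mul_left hcop.pow_right hcop.pow_right).dvd_of_dvd_mul_right hd)

theorem aux_univ (a b c x y z u v w : ℤ) (h : a * x ^ 2 + b * y ^ 2 + c * z ^ 2 = 0)
    (h1 : a * x * u + b * y * v + c * z * w = 1)
    (ho : (a * u ^ 2 + b * v ^ 2 + c * w ^ 2) % 2 = 1) (h4 : ¬ (2 * 2 ∣ a * b * c)) (n : ℤ) :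
    ∃ x y z : ℤ, a * x ^ 2 + b * y ^ 2 + c * z ^ 2 = n := by
  obtain ⟨m, hm⟩ : ∃ m, m = a * u ^ 2 + b * v ^ 2 + c * w ^ 2 := ⟨_, rfl⟩
  obtain ⟨d, hd⟩ : ∃ d, d = a * b * c := ⟨_, rfl⟩
  rw [← hm] at ho
  rw [← hd] at h4
  have key : ∀ s t r : ℤ, 2 * s * t + m * t ^ 2 - d * r ^ 2 = n →
      ∃ x y z : ℤ, a * x ^ 2 + b * y ^ 2 + c * z ^ 2 = n := by
    intro s t r hn
    refine ⟨s * x + t * u + r * (b * c * (y * w - z * v)),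
      s * y + t * v + r * (a * c * (z * u - x * w)),
      s * z + t * w + r * (a * b * (x * v - y * u)), ?_⟩
    rw [← hn, hm, hd]
    linear_combination (s ^ 2 + r ^ 2 * (a * b * c) * (a * u ^ 2 + b * v ^ 2 + c * w ^ 2)) * h
      + (2 * s * t - r ^ 2 * (a * b * c) * (a * x * u + b * y * v + c * z * w + 1)) * h1
  by_cases hn : n % 2 = 1
  · exact key ((n - m) / 2) 1 0 (by ring_nf; omega)
  by_cases hdo : d % 2 = 1
  · exact key ((n - m + d) / 2) 1 1 (by ring_nf; omega)
  by_cases hn4 : n % 4 = 0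
  · exact key (n / 4 - m) 2 0 (by ring_nf; omega)
  · exact key ((n + d) / 4 - m) 2 1 (by ring_nf; omega)

theorem stmt15 (a b c : ℤ) (ha : a ≠ 0) (hb : b ≠ 0) (hc : c ≠ 0)
    (hsf : Squarefree (a * b * c)) :
    (∀ n : ℤ, ∃ x y z : ℤ, a * x ^ 2 + b * y ^ 2 + c * z ^ 2 = n) ↔
      (∃ x y z : ℤ, ¬ (x = 0 ∧ y = 0 ∧ z = 0) ∧ a * x ^ 2 + b * y ^ 2 + c * z ^ 2 = 0) := by
  constructor
  · intro h
    obtain ⟨x, y, z, h⟩ := h (-(a * b * c))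
    exact aux_conv a b c x y z hb hc h
  rintro ⟨x0, y0, z0, hne, h0⟩
  have sq : ∀ p : ℤ, Prime p → ¬ p * p ∣ a * b * c := fun p hp hd => hp.not_unit (hsf p hd)
  -- primitive zero
  obtain ⟨x, y, z, hprim, h⟩ : ∃ x y z : ℤ, (∀ p : ℤ, Prime p → ¬ (p ∣ x ∧ p ∣ y ∧ p ∣ z)) ∧
      a * x ^ 2 + b * y ^ 2 + c * z ^ 2 = 0 := by
    obtain ⟨g, hg⟩ : ∃ g, g = gcd x0 (gcd y0 z0) := ⟨_, rfl⟩
    have hg0 : g ≠ 0 := by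
      rintro rfl
      have := hg.symm
      rw [gcd_eq_zero_iff, gcd_eq_zero_iff] at this
      exact hne this
    obtain ⟨x, hx⟩ : g ∣ x0 := hg ▸ gcd_dvd_left _ _
    obtain ⟨y, hy⟩ : g ∣ y0 := hg ▸ (gcd_dvd_right _ _).trans (gcd_dvd_left _ _)
    obtain ⟨z, hz⟩ : g ∣ z0 := hg ▸ (gcd_dvd_right _ _).trans (gcd_dvd_right _ _)
    refine ⟨x, y, z, ?_, ?_⟩
    · rintro p hp ⟨h1, h2, h3⟩
      have : g * p ∣ g := by
        conv_rhs => rw [hg]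
        refine dvd_gcd ?_ (dvd_gcd ?_ ?_)
        · rw [hx]; exact mul_dvd_mul_left g h1
        · rw [hy]; exact mul_dvd_mul_left g h2
        · rw [hz]; exact mul_dvd_mul_left g h3
      have h5 : g * p ∣ g * 1 := by rwa [mul_one]
      exact hp.not_unit (isUnit_of_dvd_one ((mul_dvd_mul_iff_left hg0).1 h5))
    · subst hx hy hz
      have : g ^ 2 * (a * x ^ 2 + b * y ^ 2 + c * z ^ 2) = 0 := by linear_combination h0
      exact (mul_eq_zero.1 this).resolve_left (pow_ne_zero 2 hg0)
  -- coprimality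
  have cop : ∀ p : ℤ, Prime p → ¬ (p ∣ a * x ∧ p ∣ b * y ∧ p ∣ c * z) := by
    rintro p hp ⟨h1, h2, h3⟩
    have hs := sq p hp
    have hab : ¬ (p ∣ a ∧ p ∣ b) := fun hh => hs ((mul_dvd_mul hh.1 hh.2).mul_right c)
    have hac : ¬ (p ∣ a ∧ p ∣ c) := fun hh => hs (by
      have := (mul_dvd_mul hh.1 hh.2).mul_right b
      rwa [mul_right_comm] at this)
    have hbc : ¬ (p ∣ b ∧ p ∣ c) := fun hh => hs (by
      have := (mul_dvd_mul hh.1 hh.2).mul_left a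
      rwa [← mul_assoc] at this)
    have ha2 : ¬ p * p ∣ a := fun hh => hs ((hh.mul_right b).mul_right c)
    have hb2 : ¬ p * p ∣ b := fun hh => hs ((hh.mul_left a).mul_right c)
    have hc2 : ¬ p * p ∣ c := fun hh => hs (hh.mul_left (a * b))
    by_cases pa : p ∣ a
    · have := aux_dvd p b c a y z x hp (fun q => hab ⟨pa, q⟩) (fun q => hac ⟨pa, q⟩) ha2
        (by linear_combination h) h2 h3
      exact hprim p hp ⟨this.2.2, this.1, this.2.1⟩
    by_cases pb : p ∣ b
    · have := aux_dvd p a c b x z y hp pa (fun q => hbc ⟨pb, q⟩) hb2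
        (by linear_combination h) h1 h3
      exact hprim p hp ⟨this.1, this.2.2, this.2.1⟩
    · exact hprim p hp (aux_dvd p a b c x y z hp pa pb hc2 h h1 h2)
  obtain ⟨u, v, w, h1⟩ : ∃ u v w : ℤ, a * x * u + b * y * v + c * z * w = 1 := by
    have hg : Int.gcd (a * x) (Int.gcd (b * y) (c * z)) = 1 := by
      by_contra hg
      obtain ⟨p, hp, hd⟩ := Nat.exists_prime_and_dvd hg
      have hd' : (p : ℤ) ∣ Int.gcd (a * x) (Int.gcd (b * y) (c * z)) := by exact_mod_cast hd
      have h2 := hd'.trans (Int.gcd_dvd_right _ _)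
      exact cop p (Nat.prime_iff_prime_int.1 hp) ⟨hd'.trans (Int.gcd_dvd_left _ _),
        h2.trans (Int.gcd_dvd_left _ _), h2.trans (Int.gcd_dvd_right _ _)⟩
    have e1 := Int.gcd_eq_gcd_ab (a * x) (Int.gcd (b * y) (c * z))
    have e2 := Int.gcd_eq_gcd_ab (b * y) (c * z)
    rw [hg] at e1
    generalize Int.gcdB (a * x) (Int.gcd (b * y) (c * z)) = B at e1
    generalize Int.gcdA (a * x) (Int.gcd (b * y) (c * z)) = A at e1
    rw [e2] at e1
    push_cast at e1
    refine ⟨A, Int.gcdA (b * y) (c * z) * B, Int.gcdB (b * y) (c * z) * B, ?_⟩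
    linear_combination -e1
  have h4 : ¬ 2 * 2 ∣ a * b * c := sq 2 Int.prime_two
  intro n
  by_cases ho : (a * u ^ 2 + b * v ^ 2 + c * w ^ 2) % 2 = 1
  · exact aux_univ a b c x y z u v w h h1 ho h4 n
  obtain ⟨m, hm⟩ : ∃ m, a * u ^ 2 + b * v ^ 2 + c * w ^ 2 = 2 * m :=
    ⟨(a * u ^ 2 + b * v ^ 2 + c * w ^ 2) / 2, by omega⟩
  by_cases hao : a % 2 = 1
  · refine aux_univ a b c x y z ((1 - a * x) * u + 1) ((1 - a * x) * v) ((1 - a * x) * w) h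
      (by linear_combination (1 - a * x) * h1) ?_ h4 n
    rw [show a * ((1 - a * x) * u + 1) ^ 2 + b * ((1 - a * x) * v) ^ 2 + c * ((1 - a * x) * w) ^ 2
      = a + 2 * ((1 - a * x) ^ 2 * m + a * (1 - a * x) * u) by
        linear_combination (1 - a * x) ^ 2 * hm]
    omega
  by_cases hbo : b % 2 = 1
  · refine aux_univ a b c x y z ((1 - b * y) * u) ((1 - b * y) * v + 1) ((1 - b * y) * w) h
      (by linear_combination (1 - b * y) * h1) ?_ h4 n
    rw [show a * ((1 - b * y) * u) ^ 2 + b * ((1 - b * y) * v + 1) ^ 2 + c * ((1 - b * y) * w) ^ 2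
      = b + 2 * ((1 - b * y) ^ 2 * m + b * (1 - b * y) * v) by
        linear_combination (1 - b * y) ^ 2 * hm]
    omega
  · exact absurd ((mul_dvd_mul (show (2 : ℤ) ∣ a by omega) (show (2 : ℤ) ∣ b by omega)).mul_right c) h4
end

section
/- Let a, b, c be positive integers (with no square-free or coprimality assumptions) and write abc = R²·S where S is a square-free positive integer and R is a positive integer. Then every integer N with N ≡ -S (mod 8·abc·S) is not represented over the rationals by the form ax² + by² + cz², and in particular every integer N with N ≡ -abc (mod 8(abc)²) is not represented over the rationals by this form. -/
lemma loc_sq (p : ℕ) [Fact p.Prime] (a b c M X Y Z W : ℤ) (ha : (p : ℤ) ∣ a)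
    (ha2 : ¬ (p : ℤ) ^ 2 ∣ a) (hb : ¬ (p : ℤ) ∣ b) (hc : ¬ (p : ℤ) ∣ c) (hM : (p : ℤ) ∣ M + 1)
    (h : a * X ^ 2 + b * Y ^ 2 + c * Z ^ 2 = a * b * c * M * W ^ 2)
    (hprim : ¬ ((p : ℤ) ∣ X ∧ (p : ℤ) ∣ Y ∧ (p : ℤ) ∣ Z ∧ (p : ℤ) ∣ W)) :
    IsSquare ((-(b * c) : ℤ) : ZMod p) := by
  have hp : Prime (p : ℤ) := Nat.prime_iff_prime_int.mp (Fact.out)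
  obtain ⟨a1, rfl⟩ := ha
  have ha1 : ¬ (p : ℤ) ∣ a1 := fun hd => ha2 (by
    rw [pow_two]; exact mul_dvd_mul_left _ hd)
  have key : ∀ U V : ℤ, ¬ (p : ℤ) ∣ V → (p : ℤ) ∣ U ^ 2 + b * c * V ^ 2 →
      IsSquare ((-(b * c) : ℤ) : ZMod p) := by
    intro U V hV hd
    rw [← ZMod.intCast_zmod_eq_zero_iff_dvd _ p] at hd hV
    push_cast at hd
    refine ⟨(U : ZMod p) / V, ?_⟩
    push_cast
    field_simp
    linear_combination -hd
  by_cases hY : (p : ℤ) ∣ Y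
  · have hZ : (p : ℤ) ∣ Z := by
      have : (p : ℤ) ∣ c * Z ^ 2 := by
        obtain ⟨y, rfl⟩ := hY
        exact ⟨a1 * b * c * M * W ^ 2 - a1 * X ^ 2 - b * p * y ^ 2, by linear_combination h⟩
      exact hp.dvd_of_dvd_pow ((hp.dvd_or_dvd this).resolve_left hc)
    have h2 : (p : ℤ) ∣ X ^ 2 + b * c * W ^ 2 := by
      obtain ⟨y, rfl⟩ := hY
      obtain ⟨z, rfl⟩ := hZ
      obtain ⟨m, hm⟩ := hM
      have : (p : ℤ) ∣ a1 * (X ^ 2 + b * c * W ^ 2) := by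
        refine ⟨a1 * b * c * m * W ^ 2 - b * y ^ 2 - c * z ^ 2, ?_⟩
        apply mul_left_cancel₀ hp.ne_zero
        linear_combination h + p * a1 * b * c * W ^ 2 * hm
      exact (hp.dvd_or_dvd this).resolve_left ha1
    by_cases hW : (p : ℤ) ∣ W
    · exfalso
      apply hprim
      refine ⟨?_, hY, hZ, hW⟩
      have : (p : ℤ) ∣ X ^ 2 := (Int.dvd_add_left (Dvd.dvd.mul_left (dvd_pow hW two_ne_zero) _)).mp h2
      exact hp.dvd_of_dvd_pow this
    · exact key X W hW h2
  · apply key (c * Z) Y hY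
    exact ⟨c * (a1 * b * c * M * W ^ 2 - a1 * X ^ 2), by linear_combination c * h⟩

lemma loc_jac (n : ℕ) (hn : 0 < n) (a b c M X Y Z W : ℤ) (ha : (n : ℤ) ∣ a)
    (ha2 : Squarefree a) (hb : IsCoprime a b) (hc : IsCoprime a c) (hM : a ∣ M + 1)
    (h : a * X ^ 2 + b * Y ^ 2 + c * Z ^ 2 = a * b * c * M * W ^ 2)
    (hprim : ∀ p : ℕ, p.Prime → ¬ ((p : ℤ) ∣ X ∧ (p : ℤ) ∣ Y ∧ (p : ℤ) ∣ Z ∧ (p : ℤ) ∣ W)) :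
    jacobiSym (-(b * c)) n = 1 := by
  have hcop : IsCoprime (-(b * c)) (n : ℤ) :=
    ((hb.mul_right hc).symm.neg_left).of_isCoprime_of_dvd_right ha
  refine (jacobiSym.eq_one_or_neg_one (Int.isCoprime_iff_gcd_eq_one.mp hcop)).resolve_right ?_
  intro hneg
  obtain ⟨p, pp, hpn, hp⟩ := jacobiSym.eq_neg_one_at_prime_divisor_of_eq_neg_one hneg
  have : Fact p.Prime := ⟨pp⟩
  have hpp : Prime (p : ℤ) := Nat.prime_iff_prime_int.mp pp
  rw [ZMod.nonsquare_iff_jacobiSym_eq_neg_one] at hp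
  have hpa : (p : ℤ) ∣ a := (Int.natCast_dvd_natCast.mpr hpn).trans ha
  refine hp (loc_sq p a b c M X Y Z W hpa ?_ ?_ ?_ (hpa.trans hM) h (hprim p pp))
  · intro hd
    rw [pow_two] at hd
    exact hpp.not_isUnit (ha2 _ hd)
  · intro hd; exact hpp.not_isUnit (hb.isUnit_of_dvd' hpa hd)
  · intro hd; exact hpp.not_isUnit (hc.isUnit_of_dvd' hpa hd)

lemma rec_q {a b : ℕ} (ha : a % 2 = 1) (hb : b % 2 = 1) :
    jacobiSym b a = (if a % 4 = 3 ∧ b % 4 = 3 then -1 else 1) * jacobiSym a b := by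
  rw [← jacobiSym.quadratic_reciprocity_if ha hb]
  split_ifs <;> simp

lemma sign_prod (t a b c : ℕ) (ha : a % 2 = 1) (hb : b % 2 = 1) (hc : c % 2 = 1)
    (hab : a.Coprime b) (hac : a.Coprime c) (hbc : b.Coprime c)
    (h1 : jacobiSym (-(b * c)) a = 1) (h2 : jacobiSym (-((t * a) * c)) b = 1)
    (h3 : jacobiSym (-((t * a) * b)) c = 1) :
    ((if a % 4 = 1 then 1 else -1) * (if b % 4 = 1 then 1 else -1) *
      (if c % 4 = 1 then 1 else -1) *
      ((if a % 4 = 3 ∧ b % 4 = 3 then -1 else 1) * (if a % 4 = 3 ∧ c % 4 = 3 then -1 else 1)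
        * (if b % 4 = 3 ∧ c % 4 = 3 then -1 else 1)) *
      (jacobiSym t b * jacobiSym t c) : ℤ) = 1 := by
  have chi : ∀ n : ℕ, n % 2 = 1 → ZMod.χ₄ (n : ZMod 4) = if n % 4 = 1 then 1 else -1 := by
    intro n hn
    rw [ZMod.χ₄_nat_eq_if_mod_four]
    simp [hn]
  rw [jacobiSym.neg _ (Nat.odd_iff.mpr ha), jacobiSym.mul_left, rec_q ha hb, rec_q ha hc,
    chi a ha] at h1
  rw [jacobiSym.neg _ (Nat.odd_iff.mpr hb), jacobiSym.mul_left, jacobiSym.mul_left,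
    rec_q hb hc, chi b hb] at h2
  rw [jacobiSym.neg _ (Nat.odd_iff.mpr hc), jacobiSym.mul_left, jacobiSym.mul_left,
    chi c hc] at h3
  have e1 := jacobiSym.sq_one (a := (a : ℤ)) (b := b) (by simpa using hab)
  have e2 := jacobiSym.sq_one (a := (a : ℤ)) (b := c) (by simpa using hac)
  have e3 := jacobiSym.sq_one (a := (b : ℤ)) (b := c) (by simpa using hbc)
  generalize jacobiSym a b = u at *
  generalize jacobiSym a c = v at *
  generalize jacobiSym b c = w at *
  generalize jacobiSym t b = r at *
  generalize jacobiSym t c = s at *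
  generalize (if a % 4 = 1 then (1 : ℤ) else -1) = x1 at *
  generalize (if b % 4 = 1 then (1 : ℤ) else -1) = x2 at *
  generalize (if c % 4 = 1 then (1 : ℤ) else -1) = x3 at *
  generalize (if a % 4 = 3 ∧ b % 4 = 3 then (-1 : ℤ) else 1) = y1 at *
  generalize (if a % 4 = 3 ∧ c % 4 = 3 then (-1 : ℤ) else 1) = y2 at *
  generalize (if b % 4 = 3 ∧ c % 4 = 3 then (-1 : ℤ) else 1) = y3 at *
  have : (x1 * x2 * x3 * (y1 * y2 * y3) * (r * s)) * (u ^ 2 * v ^ 2 * w ^ 2) = 1 := by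
    calc _ = (x1 * (y1 * u * (y2 * v))) * (x2 * (r * u * (y3 * w))) * (x3 * (s * v * w)) := by ring
      _ = 1 := by rw [h1, h2, h3]; rfl
  rw [e1, e2, e3] at this
  simpa using this

lemma odd_base (a b c : ℕ) (ha : a % 2 = 1) (hb : b % 2 = 1) (hc : c % 2 = 1)
    (M X Y Z W : ℤ) (hM : (8 : ℤ) ∣ M + 1)
    (h : (a : ℤ) * X ^ 2 + b * Y ^ 2 + c * Z ^ 2 = a * b * c * M * W ^ 2)
    (hprim : ¬ ((2 : ℤ) ∣ X ∧ (2 : ℤ) ∣ Y ∧ (2 : ℤ) ∣ Z ∧ (2 : ℤ) ∣ W))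
    (hab : a % 4 = b % 4) (hac : a % 4 = c % 4) : False := by
  have h4 : ((X : ZMod 4) ^ 2 + (Y : ZMod 4) ^ 2 + (Z : ZMod 4) ^ 2 + (W : ZMod 4) ^ 2) = 0 := by
    have h' := congrArg (Int.cast : ℤ → ZMod 4) h
    push_cast at h'
    have eb : (b : ZMod 4) = a := ((ZMod.natCast_eq_natCast_iff' a b 4).mpr hab).symm
    have ec : (c : ZMod 4) = a := ((ZMod.natCast_eq_natCast_iff' a c 4).mpr hac).symm
    have eM : (M : ZMod 4) = -1 := by
      have := (ZMod.intCast_zmod_eq_zero_iff_dvd (M + 1) 4).mpr ((by norm_num : ((4 : ℕ) : ℤ) ∣ 8).trans hM)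
      push_cast at this
      linear_combination this
    have ea : (a : ZMod 4) ^ 2 = 1 := by
      have : a % 4 = 1 ∨ a % 4 = 3 := by omega
      rcases this with h | h
      · have : (a : ZMod 4) = (1 : ℕ) := (ZMod.natCast_eq_natCast_iff' a 1 4).mpr h
        rw [this]; decide
      · have : (a : ZMod 4) = (3 : ℕ) := (ZMod.natCast_eq_natCast_iff' a 3 4).mpr h
        rw [this]; decide
    rw [eb, ec, eM] at h'
    linear_combination a * h' - (X ^ 2 + Y ^ 2 + Z ^ 2 + W ^ 2 * (a ^ 2 + 1)) * ea
  have par : ∀ x : ℤ, (x % 2 = 0 ∧ (x : ZMod 4) ^ 2 = 0) ∨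
      (x % 2 = 1 ∧ (x : ZMod 4) ^ 2 = 1 ∧ (x : ZMod 8) ^ 2 = 1) := by
    intro x
    rcases Int.even_or_odd' x with ⟨k, rfl | rfl⟩
    · left
      refine ⟨by omega, ?_⟩
      push_cast
      generalize (k : ZMod 4) = q
      revert q; decide
    · right
      refine ⟨by omega, ?_, ?_⟩
      · push_cast
        generalize (k : ZMod 4) = q
        revert q; decide
      · push_cast
        generalize (k : ZMod 8) = q
        revert q; decide
  have hodd : (X : ZMod 8) ^ 2 = 1 ∧ (Y : ZMod 8) ^ 2 = 1 ∧ (Z : ZMod 8) ^ 2 = 1 ∧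
      (W : ZMod 8) ^ 2 = 1 := by
    rcases par X with hX | hX <;> rcases par Y with hY | hY <;> rcases par Z with hZ | hZ <;>
      rcases par W with hW | hW
    case inl.inl.inl.inl => exact absurd ⟨by omega, by omega, by omega, by omega⟩ hprim
    case inr.inr.inr.inr => exact ⟨hX.2.2, hY.2.2, hZ.2.2, hW.2.2⟩
    all_goals
      exfalso
      simp only [hX, hY, hZ, hW] at h4
      revert h4; decide
  have h' := congrArg (Int.cast : ℤ → ZMod 8) h
  push_cast at h'
  have eM : (M : ZMod 8) = -1 := by
    have := (ZMod.intCast_zmod_eq_zero_iff_dvd (M + 1) 8).mpr hM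
    push_cast at this
    linear_combination this
  rw [hodd.1, hodd.2.1, hodd.2.2.1, hodd.2.2.2, eM] at h'
  have h8 : ((a + b + c + a * b * c : ℕ) : ZMod 8) = 0 := by
    push_cast; linear_combination h'
  rw [ZMod.natCast_eq_zero_iff] at h8
  have fin : ∀ a < (8 : ℕ), ∀ b < (8 : ℕ), ∀ c < (8 : ℕ), a % 2 = 1 → a % 4 = b % 4 → a % 4 = c % 4 →
      (a + b + c + a * b * c) % 8 ≠ 0 := by
    have fin' : ∀ a b c : Fin 8, a.val % 2 = 1 → a.val % 4 = b.val % 4 → a.val % 4 = c.val % 4 →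
        (a.val + b.val + c.val + a.val * b.val * c.val) % 8 ≠ 0 := by decide
    intro a ha b hb c hc
    exact fin' ⟨a, ha⟩ ⟨b, hb⟩ ⟨c, hc⟩
  apply fin (a % 8) (by omega) (b % 8) (by omega) (c % 8) (by omega) (by omega) (by omega) (by omega)
  have := Nat.mod_eq_zero_of_dvd h8
  rw [← this]
  simp [Nat.add_mod, Nat.mul_mod]

lemma even_base (a b c : ℕ) (ha : a % 2 = 1) (hb : b % 2 = 1) (hc : c % 2 = 1)
    (M X Y Z W : ℤ) (hM : (8 : ℤ) ∣ M + 1)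
    (h : (2 * a : ℤ) * X ^ 2 + b * Y ^ 2 + c * Z ^ 2 = (2 * a) * b * c * M * W ^ 2)
    (hprim : ¬ ((2 : ℤ) ∣ X ∧ (2 : ℤ) ∣ Y ∧ (2 : ℤ) ∣ Z ∧ (2 : ℤ) ∣ W)) :
    ∃ e < 2, ∃ f < 2, (b + c + 2 * a * (e + b * c * f)) % 8 = 0 := by
  have cast2 : ∀ n : ℕ, n % 2 = 1 → (n : ZMod 2) = 1 := by
    intro n hn
    have : (n : ZMod 2) = (1 : ℕ) := (ZMod.natCast_eq_natCast_iff' n 1 2).mpr hn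
    simpa using this
  have sq8 : ∀ n : ℕ, n % 2 = 1 → (n : ZMod 8) ^ 2 = 1 := by
    intro n hn
    obtain ⟨k, rfl⟩ : ∃ k, n = 2 * k + 1 := ⟨n / 2, by omega⟩
    push_cast
    generalize (k : ZMod 8) = q
    revert q; decide
  have sqo : ∀ k : ℤ, ((2 * k + 1 : ℤ) : ZMod 8) ^ 2 = 1 := by
    intro k
    push_cast
    generalize (k : ZMod 8) = q
    revert q; decide
  have two : ∀ x : ZMod 8, ∃ e : ℕ, e < 2 ∧ 2 * x ^ 2 = 2 * (e : ZMod 8) := by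
    intro x
    have : 2 * x ^ 2 = 0 ∨ 2 * x ^ 2 = 2 := by revert x; decide
    rcases this with h | h
    · exact ⟨0, by omega, by simpa using h⟩
    · exact ⟨1, by omega, by simpa using h⟩
  have eM : (M : ZMod 8) = -1 := by
    have := (ZMod.intCast_zmod_eq_zero_iff_dvd (M + 1) 8).mpr hM
    push_cast at this
    linear_combination this
  have eM2 : (M : ZMod 2) = 1 := by
    have := (ZMod.intCast_zmod_eq_zero_iff_dvd (M + 1) 2).mpr ((by norm_num : ((2 : ℕ) : ℤ) ∣ 8).trans hM)
    push_cast at this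
    rw [eq_neg_of_add_eq_zero_left this]; decide
  suffices H : ∃ x y : ZMod 8, (b + c + 2 * a * (x ^ 2 + b * c * y ^ 2) : ZMod 8) = 0 by
    obtain ⟨x, y, H⟩ := H
    obtain ⟨e, he, he'⟩ := two x
    obtain ⟨f, hf, hf'⟩ := two y
    refine ⟨e, he, f, hf, ?_⟩
    apply Nat.mod_eq_zero_of_dvd
    rw [← ZMod.natCast_eq_zero_iff]
    push_cast
    linear_combination H - a * he' - a * b * c * hf'
  have hYZ : Y % 2 = Z % 2 := by
    have h' := congrArg (Int.cast : ℤ → ZMod 2) h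
    push_cast at h'
    rw [cast2 a ha, cast2 b hb, cast2 c hc] at h'
    have : (2 : ZMod 2) = 0 := by decide
    rw [this] at h'
    have h2 : (Y : ZMod 2) = Z := by
      generalize (Y : ZMod 2) = y at *
      generalize (Z : ZMod 2) = z at *
      simp only [zero_mul, zero_add, one_mul] at h'
      revert y z; decide
    exact (ZMod.intCast_eq_intCast_iff' Y Z 2).mp h2
  rcases Int.even_or_odd' Y with ⟨y, rfl | rfl⟩
  · obtain ⟨z, rfl⟩ : ∃ z, Z = 2 * z := ⟨Z / 2, by omega⟩
    have h1 : (a : ℤ) * X ^ 2 + 2 * (b * y ^ 2 + c * z ^ 2) = a * b * c * M * W ^ 2 := by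
      linarith
    have hXW : X % 2 = W % 2 := by
      have h' := congrArg (Int.cast : ℤ → ZMod 2) h1
      push_cast at h'
      rw [cast2 a ha, cast2 b hb, cast2 c hc, eM2] at h'
      have : (2 : ZMod 2) = 0 := by decide
      rw [this] at h'
      have h2 : (X : ZMod 2) = W := by
        generalize (X : ZMod 2) = y at *
        generalize (W : ZMod 2) = z at *
        simp only [zero_mul, add_zero, one_mul] at h'
        revert y z; decide
      exact (ZMod.intCast_eq_intCast_iff' X W 2).mp h2
    rcases Int.even_or_odd' X with ⟨x, rfl | rfl⟩
    · exact absurd ⟨by omega, by omega, by omega, by omega⟩ hprim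
    · obtain ⟨w, rfl⟩ : ∃ z, W = 2 * z + 1 := ⟨W / 2, by omega⟩
      have h' := congrArg (Int.cast : ℤ → ZMod 8) h1
      rw [Int.cast_add, Int.cast_mul, Int.cast_pow, sqo, Int.cast_mul _ ((2 * w + 1) ^ 2),
        Int.cast_pow, sqo] at h'
      push_cast at h'
      rw [eM] at h'
      refine ⟨y, z, ?_⟩
      have ea := sq8 a ha
      have eb := sq8 b hb
      linear_combination a * b * h' - (b + b ^ 2 * c) * ea - (c + 2 * a * y ^ 2) * eb
  · obtain ⟨z, rfl⟩ : ∃ z, Z = 2 * z + 1 := ⟨Z / 2, by omega⟩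
    have h' := congrArg (Int.cast : ℤ → ZMod 8) h
    rw [Int.cast_add, Int.cast_add, Int.cast_mul _ ((2 * y + 1) ^ 2), Int.cast_pow, sqo,
      Int.cast_mul _ ((2 * z + 1) ^ 2), Int.cast_pow, sqo] at h'
    push_cast at h'
    rw [eM] at h'
    exact ⟨X, W, by linear_combination h'⟩

set_option maxRecDepth 100000 in
set_option maxHeartbeats 1000000 in
lemma fin_even : ∀ a < (8 : ℕ), ∀ b < (8 : ℕ), ∀ c < (8 : ℕ), a % 2 = 1 → b % 2 = 1 → c % 2 = 1 →
    ∀ e < (2 : ℕ), ∀ f < (2 : ℕ), (b + c + 2 * a * (e + b * c * f)) % 8 = 0 →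
    ((if a % 4 = 1 then 1 else -1) * (if b % 4 = 1 then 1 else -1) *
      (if c % 4 = 1 then 1 else -1) *
      ((if a % 4 = 3 ∧ b % 4 = 3 then -1 else 1) * (if a % 4 = 3 ∧ c % 4 = 3 then -1 else 1)
        * (if b % 4 = 3 ∧ c % 4 = 3 then -1 else 1)) *
      ((if b % 8 = 1 ∨ b % 8 = 7 then 1 else -1) *
        (if c % 8 = 1 ∨ c % 8 = 7 then 1 else -1)) : ℤ) ≠ 1 := by
  have F : ∀ a b c : Fin 8, a.val % 2 = 1 → b.val % 2 = 1 → c.val % 2 = 1 →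
      ∀ e f : Fin 2, (b.val + c.val + 2 * a.val * (e.val + b.val * c.val * f.val)) % 8 = 0 →
      ((if a.val % 4 = 1 then 1 else -1) * (if b.val % 4 = 1 then 1 else -1) *
      (if c.val % 4 = 1 then 1 else -1) *
      ((if a.val % 4 = 3 ∧ b.val % 4 = 3 then -1 else 1) * (if a.val % 4 = 3 ∧ c.val % 4 = 3 then -1 else 1)
        * (if b.val % 4 = 3 ∧ c.val % 4 = 3 then -1 else 1)) *
      ((if b.val % 8 = 1 ∨ b.val % 8 = 7 then 1 else -1) *
        (if c.val % 8 = 1 ∨ c.val % 8 = 7 then 1 else -1)) : ℤ) ≠ 1 := by decide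
  intro a ha b hb c hc h1 h2 h3 e he f hf
  exact F ⟨a, ha⟩ ⟨b, hb⟩ ⟨c, hc⟩ h1 h2 h3 ⟨e, he⟩ ⟨f, hf⟩

lemma at_two' (b : ℕ) (hb : b % 2 = 1) :
    jacobiSym ((2 : ℕ) : ℤ) b = if b % 8 = 1 ∨ b % 8 = 7 then 1 else -1 := by
  have := jacobiSym.at_two (Nat.odd_iff.mpr hb)
  rw [ZMod.χ₈_nat_eq_if_mod_eight] at this
  simpa [hb] using this

def PP (a b c : ℕ) : Prop := ∀ M X Y Z W : ℤ, (8 * (a * b * c) : ℤ) ∣ M + 1 →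
  (a : ℤ) * X ^ 2 + b * Y ^ 2 + c * Z ^ 2 = a * b * c * M * W ^ 2 → W = 0

lemma PP.swap12 {a b c : ℕ} (h : PP a b c) : PP b a c := by
  intro M X Y Z W hM e
  exact h M Y X Z W (by convert hM using 1; ring) (by linear_combination e)

lemma PP.swap23 {a b c : ℕ} (h : PP a b c) : PP a c b := by
  intro M X Y Z W hM e
  exact h M X Z Y W (by convert hM using 1; ring) (by linear_combination e)

lemma PP.sq {a b c p : ℕ} (hp : p ≠ 0) (h : PP a b c) : PP (p * p * a) b c := by
  intro M X Y Z W hM e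
  push_cast at e hM
  have := h M (p * X) Y Z (p * W) (Dvd.dvd.trans ⟨p * p, by ring⟩ hM) (by linear_combination e)
  simpa [hp] using this

lemma PP.cop {a b c p : ℕ} (hp : p ≠ 0) (h : PP a b (c * p)) : PP (p * a) (p * b) c := by
  intro M X Y Z W hM e
  push_cast at e hM
  have := h M (p * X) (p * Y) Z (p * W) (Dvd.dvd.trans ⟨p, by push_cast; ring⟩ hM)
    (by push_cast; linear_combination p * e)
  simpa [hp] using this

lemma PP.prim {a b c : ℕ} (h : ∀ M X Y Z W : ℤ, (8 * (a * b * c) : ℤ) ∣ M + 1 →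
    (a : ℤ) * X ^ 2 + b * Y ^ 2 + c * Z ^ 2 = a * b * c * M * W ^ 2 →
    (∀ p : ℕ, p.Prime → ¬ ((p : ℤ) ∣ X ∧ (p : ℤ) ∣ Y ∧ (p : ℤ) ∣ Z ∧ (p : ℤ) ∣ W)) → False) :
    PP a b c := by
  intro M X Y Z W hM e
  by_contra hW
  induction hn : W.natAbs using Nat.strong_induction_on generalizing X Y Z W with
  | _ n ih =>
    by_cases hp : ∃ p : ℕ, p.Prime ∧ ((p : ℤ) ∣ X ∧ (p : ℤ) ∣ Y ∧ (p : ℤ) ∣ Z ∧ (p : ℤ) ∣ W)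
    · obtain ⟨p, pp, ⟨x, rfl⟩, ⟨y, rfl⟩, ⟨z, rfl⟩, ⟨w, rfl⟩⟩ := hp
      have hp0 : (p : ℤ) ≠ 0 := by exact_mod_cast pp.ne_zero
      have hw : w ≠ 0 := by rintro rfl; simp at hW
      refine ih w.natAbs ?_ x y z w ?_ hw rfl
      · rw [← hn, Int.natAbs_mul, Int.natAbs_natCast]
        have := Int.natAbs_pos.mpr hw
        nlinarith [pp.two_le]
      · apply mul_left_cancel₀ (pow_ne_zero 2 hp0)
        linear_combination e
    · push Not at hp
      exact h M X Y Z W hM e (fun p pp hh => hp p pp hh.1 hh.2.1 hh.2.2.1 hh.2.2.2)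

lemma sqfree_cast {a : ℕ} (h : Squarefree a) : Squarefree (a : ℤ) :=
  Int.squarefree_natCast.mpr h

lemma PP.base_odd {a b c : ℕ} (ha : a % 2 = 1) (hb : b % 2 = 1) (hc : c % 2 = 1)
    (sa : Squarefree a) (sb : Squarefree b) (sc : Squarefree c)
    (hab : a.Coprime b) (hac : a.Coprime c) (hbc : b.Coprime c) : PP a b c := by
  apply PP.prim
  intro M X Y Z W hM e hprim
  have ab : IsCoprime (a : ℤ) b := Nat.isCoprime_iff_coprime.mpr hab
  have ac : IsCoprime (a : ℤ) c := Nat.isCoprime_iff_coprime.mpr hac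
  have bc : IsCoprime (b : ℤ) c := Nat.isCoprime_iff_coprime.mpr hbc
  have hMa : (a : ℤ) ∣ M + 1 := Dvd.dvd.trans ⟨8 * b * c, by ring⟩ hM
  have hMb : (b : ℤ) ∣ M + 1 := Dvd.dvd.trans ⟨8 * a * c, by ring⟩ hM
  have hMc : (c : ℤ) ∣ M + 1 := Dvd.dvd.trans ⟨8 * a * b, by ring⟩ hM
  have hM8 : (8 : ℤ) ∣ M + 1 := Dvd.dvd.trans ⟨a * b * c, by ring⟩ hM
  have j1 := loc_jac a (by omega) a b c M X Y Z W dvd_rfl (sqfree_cast sa) ab ac hMa e hprim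
  have j2 := loc_jac b (by omega) b a c M Y X Z W dvd_rfl (sqfree_cast sb) ab.symm bc hMb
    (by linear_combination e) (fun p pp hh => hprim p pp ⟨hh.2.1, hh.1, hh.2.2⟩)
  have j3 := loc_jac c (by omega) c a b M Z X Y W dvd_rfl (sqfree_cast sc) ac.symm bc.symm hMc
    (by linear_combination e) (fun p pp hh => hprim p pp ⟨hh.2.1, hh.2.2.1, hh.1, hh.2.2.2⟩)
  have s := sign_prod 1 a b c ha hb hc hab hac hbc j1 (by simpa using j2) (by simpa using j3)
  have key := odd_base a b c ha hb hc M X Y Z W hM8 e (by simpa using hprim 2 Nat.prime_two)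
  rw [Nat.cast_one, jacobiSym.one_left, jacobiSym.one_left] at s
  have ha4 : a % 4 = 1 ∨ a % 4 = 3 := by omega
  have hb4 : b % 4 = 1 ∨ b % 4 = 3 := by omega
  have hc4 : c % 4 = 1 ∨ c % 4 = 3 := by omega
  rcases ha4 with ha4 | ha4 <;> rcases hb4 with hb4 | hb4 <;> rcases hc4 with hc4 | hc4 <;>
    simp [ha4, hb4, hc4] at s key

lemma PP.base_even {a b c : ℕ} (hb : b % 2 = 1) (hc : c % 2 = 1)
    (sa : Squarefree (2 * a)) (sb : Squarefree b) (sc : Squarefree c)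
    (hab : (2 * a).Coprime b) (hac : (2 * a).Coprime c) (hbc : b.Coprime c) : PP (2 * a) b c := by
  have ha : a % 2 = 1 := by
    by_contra hcon
    have := sa 2 ⟨a / 2, by omega⟩
    simp at this
  apply PP.prim
  intro M X Y Z W hM e hprim
  have ab : IsCoprime ((2 * a : ℕ) : ℤ) b := Nat.isCoprime_iff_coprime.mpr hab
  have ac : IsCoprime ((2 * a : ℕ) : ℤ) c := Nat.isCoprime_iff_coprime.mpr hac
  have bc : IsCoprime (b : ℤ) c := Nat.isCoprime_iff_coprime.mpr hbc
  have hMa : ((2 * a : ℕ) : ℤ) ∣ M + 1 := Dvd.dvd.trans ⟨8 * b * c, by ring⟩ hM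
  have hMb : (b : ℤ) ∣ M + 1 := Dvd.dvd.trans ⟨8 * (2 * a : ℕ) * c, by ring⟩ hM
  have hMc : (c : ℤ) ∣ M + 1 := Dvd.dvd.trans ⟨8 * (2 * a : ℕ) * b, by ring⟩ hM
  have hM8 : (8 : ℤ) ∣ M + 1 := Dvd.dvd.trans ⟨(2 * a : ℕ) * b * c, by ring⟩ hM
  have j1 := loc_jac a (by omega) (2 * a : ℕ) b c M X Y Z W ⟨2, by push_cast; ring⟩
    (sqfree_cast sa) ab ac hMa e hprim
  have j2 := loc_jac b (by omega) b (2 * a : ℕ) c M Y X Z W dvd_rfl (sqfree_cast sb) ab.symm bc hMb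
    (by linear_combination e) (fun p pp hh => hprim p pp ⟨hh.2.1, hh.1, hh.2.2⟩)
  have j3 := loc_jac c (by omega) c (2 * a : ℕ) b M Z X Y W dvd_rfl (sqfree_cast sc) ac.symm
    bc.symm hMc
    (by linear_combination e) (fun p pp hh => hprim p pp ⟨hh.2.1, hh.2.2.1, hh.1, hh.2.2.2⟩)
  rw [Nat.cast_mul] at j2 j3
  have s := sign_prod 2 a b c ha hb hc hab.coprime_mul_left hac.coprime_mul_left hbc j1 j2 j3
  obtain ⟨x, hx, y, hy, key⟩ := even_base a b c ha hb hc M X Y Z W hM8 (by push_cast at e; exact e)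
    (by simpa using hprim 2 Nat.prime_two)
  rw [at_two' b hb, at_two' c hc] at s
  have m4 : ∀ n : ℕ, n % 8 % 4 = n % 4 := by intro n; omega
  have m8 : ∀ n : ℕ, n % 8 % 8 = n % 8 := by intro n; omega
  have F := fin_even (a % 8) (by omega) (b % 8) (by omega) (c % 8) (by omega) (by omega)
    (by omega) (by omega) x hx y hy (by rw [← key]; simp [Nat.add_mod, Nat.mul_mod])
  simp only [m4, m8] at F
  exact F s

lemma PP.base {a b c : ℕ} (sa : Squarefree a) (sb : Squarefree b) (sc : Squarefree c)
    (hab : a.Coprime b) (hac : a.Coprime c) (hbc : b.Coprime c) : PP a b c := by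
  have co : ∀ {m n : ℕ}, m.Coprime n → m % 2 = 0 → n % 2 = 1 := by
    intro m n h hm
    by_contra hn
    have := Nat.dvd_gcd (Nat.dvd_of_mod_eq_zero hm) (show 2 ∣ n by omega)
    rw [h] at this
    omega
  by_cases ha : a % 2 = 0
  · obtain ⟨a', rfl⟩ := Nat.dvd_of_mod_eq_zero ha
    exact base_even (co hab ha) (co hac ha) sa sb sc hab hac hbc
  by_cases hb : b % 2 = 0
  · obtain ⟨a', rfl⟩ := Nat.dvd_of_mod_eq_zero hb
    exact (base_even (co hab.symm hb) (co hbc hb) sb sa sc hab.symm hbc hac).swap12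
  by_cases hc : c % 2 = 0
  · obtain ⟨a', rfl⟩ := Nat.dvd_of_mod_eq_zero hc
    exact (base_even (co hac.symm hc) (co hbc.symm hc) sc sa sb hac.symm hbc.symm
      hab).swap12.swap23
  exact base_odd (by omega) (by omega) (by omega) sa sb sc hab hac hbc

lemma PP.all (n : ℕ) : ∀ a b c : ℕ, 0 < a → 0 < b → 0 < c → a * b * c = n → PP a b c := by
  induction n using Nat.strong_induction_on with
  | _ n ih =>
    have S : ∀ a b c : ℕ, 0 < a → 0 < b → 0 < c → a * b * c = n → ¬ Squarefree a → PP a b c := by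
      intro a b c ha hb hc hn hs
      rw [Nat.squarefree_iff_prime_squarefree] at hs
      push Not at hs
      obtain ⟨p, pp, a', rfl⟩ := hs
      have ha' : 0 < a' := Nat.pos_of_mul_pos_left ha
      refine PP.sq pp.ne_zero (ih _ ?_ a' b c ha' hb hc rfl)
      have h1 : 0 < a' * b * c := by positivity
      have h2 : n = p * p * (a' * b * c) := by rw [← hn]; ring
      have := pp.two_le
      have : 2 * 2 ≤ p * p := Nat.mul_le_mul this this
      nlinarith
    have C : ∀ a b c : ℕ, 0 < a → 0 < b → 0 < c → a * b * c = n → ¬ a.Coprime b → PP a b c := by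
      intro a b c ha hb hc hn hs
      rw [Nat.Prime.not_coprime_iff_dvd] at hs
      obtain ⟨p, pp, ⟨a', rfl⟩, b', rfl⟩ := hs
      have ha' : 0 < a' := Nat.pos_of_mul_pos_left ha
      have hb' : 0 < b' := Nat.pos_of_mul_pos_left hb
      refine PP.cop pp.ne_zero (ih _ ?_ a' b' (c * p) ha' hb' (Nat.mul_pos hc pp.pos) rfl)
      have h1 : 0 < a' * b' * (c * p) := Nat.mul_pos (Nat.mul_pos ha' hb') (Nat.mul_pos hc pp.pos)
      have h2 : n = p * (a' * b' * (c * p)) := by rw [← hn]; ring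
      have := pp.two_le
      nlinarith
    intro a b c ha hb hc hn
    by_cases sa : Squarefree a
    swap
    · exact S a b c ha hb hc hn sa
    by_cases sb : Squarefree b
    swap
    · exact (S b a c hb ha hc (by rw [← hn]; ring) sb).swap12
    by_cases sc : Squarefree c
    swap
    · exact (S c a b hc ha hb (by rw [← hn]; ring) sc).swap12.swap23
    by_cases ab : a.Coprime b
    swap
    · exact C a b c ha hb hc hn ab
    by_cases ac : a.Coprime c
    swap
    · exact (C a c b ha hc hb (by rw [← hn]; ring) ac).swap23
    by_cases bc : b.Coprime c
    swap
    · exact (C b c a hb hc ha (by rw [← hn]; ring) bc).swap23.swap12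
    exact PP.base sa sb sc ab ac bc

lemma not_rep (a b c R M N : ℤ) (hapos : 0 < a) (hbpos : 0 < b) (hcpos : 0 < c)
    (hM : 8 * (a * b * c) ∣ M + 1) (hN : R ^ 2 * N = a * b * c * M) :
    ¬ ∃ x y z : ℚ, (a : ℚ) * x ^ 2 + (b : ℚ) * y ^ 2 + (c : ℚ) * z ^ 2 = (N : ℚ) := by
  rintro ⟨x, y, z, h⟩
  lift a to ℕ using hapos.le
  lift b to ℕ using hbpos.le
  lift c to ℕ using hcpos.le
  have P := PP.all _ a b c (by omega) (by omega) (by omega) rfl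
  have hx : (x.den : ℚ) ≠ 0 := by exact_mod_cast x.den_ne_zero
  have hy : (y.den : ℚ) ≠ 0 := by exact_mod_cast y.den_ne_zero
  have hz : (z.den : ℚ) ≠ 0 := by exact_mod_cast z.den_ne_zero
  have := P M (R * (x.num * y.den * z.den)) (R * (y.num * x.den * z.den))
    (R * (z.num * x.den * y.den)) (x.den * y.den * z.den) hM (by
      have hN' : (R : ℚ) ^ 2 * N = a * b * c * M := by exact_mod_cast hN
      have ex : (x.num : ℚ) = x * x.den := (Rat.mul_den_eq_num x).symm
      have ey : (y.num : ℚ) = y * y.den := (Rat.mul_den_eq_num y).symm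
      have ez : (z.num : ℚ) = z * z.den := (Rat.mul_den_eq_num z).symm
      have : ((a : ℚ) * (R * (x.num * y.den * z.den)) ^ 2 + b * (R * (y.num * x.den * z.den)) ^ 2
        + c * (R * (z.num * x.den * y.den)) ^ 2) = a * b * c * M * (x.den * y.den * z.den) ^ 2 := by
        rw [ex, ey, ez]
        linear_combination (x.den * y.den * z.den : ℚ) ^ 2 * (R ^ 2 * h + hN')
      exact_mod_cast this)
  have h0 : (x.den : ℤ) * y.den * z.den ≠ 0 := by positivity
  exact h0 this

theorem stmt16 (a b c R S : ℤ) (hapos : 0 < a) (hbpos : 0 < b) (hcpos : 0 < c)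
    (hRpos : 0 < R) (hSpos : 0 < S) (hS : Squarefree S) (habc : a * b * c = R ^ 2 * S) :
    (∀ N : ℤ, N ≡ -S [ZMOD 8 * (a * b * c) * S] →
      ¬ ∃ x y z : ℚ, (a : ℚ) * x ^ 2 + (b : ℚ) * y ^ 2 + (c : ℚ) * z ^ 2 = (N : ℚ)) ∧
    (∀ N : ℤ, N ≡ -(a * b * c) [ZMOD 8 * (a * b * c) ^ 2] →
      ¬ ∃ x y z : ℚ, (a : ℚ) * x ^ 2 + (b : ℚ) * y ^ 2 + (c : ℚ) * z ^ 2 = (N : ℚ)) := by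
  constructor
  · intro N hN
    obtain ⟨k, hk⟩ := hN.symm.dvd
    refine not_rep a b c R (-1 + 8 * (a * b * c) * k) N hapos hbpos hcpos ⟨k, by ring⟩ ?_
    linear_combination R ^ 2 * hk + (1 - 8 * (a * b * c) * k) * habc
  · intro N hN
    obtain ⟨k, hk⟩ := hN.symm.dvd
    refine not_rep a b c 1 (-1 + 8 * (a * b * c) * k) N hapos hbpos hcpos ⟨k, by ring⟩ ?_
    linear_combination hk
end

section
/- A positive integer n is represented over the rationals by the form x² + y² + 10z² (i.e., there exist rational x, y, z with x² + y² + 10z² = n) if and only if n is not of the form 4^m(16k + 6) for some nonnegative integers m and k. -/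
lemma leg (N c : ℕ) (hN : 0 < N) (hc : 0 < c) (hsq : ¬ IsSquare c) (s : ℤ)
    (h1 : (N : ℤ) ∣ c + 1) (h2 : (c : ℤ) ∣ s ^ 2 - N) :
    ∃ W Z U : ℤ, W ≠ 0 ∧ N * W ^ 2 = Z ^ 2 + c * U ^ 2 := by
  have : NeZero N := ⟨hN.ne'⟩
  have : NeZero c := ⟨hc.ne'⟩
  let S := Finset.range (Nat.sqrt (N * c) + 1) ×ˢ
    (Finset.range (Nat.sqrt N + 1) ×ˢ Finset.range (Nat.sqrt c + 1))
  let f : ℕ × ℕ × ℕ → ZMod N × ZMod c := fun v =>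
    (((v.1 : ℤ) - v.2.1 : ℤ), ((v.1 : ℤ) - s * v.2.2 : ℤ))
  have hcard : (Finset.univ : Finset (ZMod N × ZMod c)).card < S.card := by
    simp only [S, Finset.card_univ, Fintype.card_prod, ZMod.card, Finset.card_product,
      Finset.card_range]
    have a1 := Nat.lt_succ_sqrt (N * c)
    have a2 := Nat.lt_succ_sqrt N
    have a3 := Nat.lt_succ_sqrt c
    simp only [Nat.succ_eq_add_one] at a1 a2 a3
    have a4 := Nat.mul_lt_mul'' a2 a3
    have a5 := Nat.mul_lt_mul'' a1 a4
    have : (N * c) * (N * c) < ((Nat.sqrt (N * c) + 1) * ((Nat.sqrt N + 1) * (Nat.sqrt c + 1))) * ((Nat.sqrt (N * c) + 1) * ((Nat.sqrt N + 1) * (Nat.sqrt c + 1))) := by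
      calc _ < _ := a5
        _ = _ := by ring
    exact Nat.mul_self_lt_mul_self_iff.mp this
  obtain ⟨⟨z1, u1, w1⟩, m1, ⟨z2, u2, w2⟩, m2, hne, heq⟩ :=
    Finset.exists_ne_map_eq_of_card_lt_of_maps_to hcard (f := f) (fun _ _ => Finset.mem_coe.2 (Finset.mem_univ _))
  simp only [S, Finset.mem_product, Finset.mem_range, Nat.lt_succ_iff] at m1 m2
  simp only [f, Prod.mk.injEq] at heq
  obtain ⟨e1, e2⟩ := heq
  rw [ZMod.intCast_eq_intCast_iff_dvd_sub] at e1 e2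
  have bd : ∀ (a b K : ℕ), a ≤ Nat.sqrt K → b ≤ Nat.sqrt K → ((b : ℤ) - a) ^ 2 ≤ K := by
    intro a b K ha hb
    have hk : ((Nat.sqrt K : ℕ) : ℤ) ^ 2 ≤ K := by exact_mod_cast Nat.sqrt_le' K
    refine le_trans ?_ hk
    apply sq_le_sq'
    · have : (a : ℤ) ≤ Nat.sqrt K := by exact_mod_cast ha
      have : (0 : ℤ) ≤ b := by positivity
      linarith
    · have : (b : ℤ) ≤ Nat.sqrt K := by exact_mod_cast hb
      have : (0 : ℤ) ≤ a := by positivity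
      linarith
  have bz := bd z1 z2 _ m1.1 m2.1
  have bu := bd u1 u2 _ m1.2.1 m2.2.1
  have bw := bd w1 w2 _ m1.2.2 m2.2.2
  have hne' : ¬ ((z2 : ℤ) - z1 = 0 ∧ (u2 : ℤ) - u1 = 0 ∧ (w2 : ℤ) - w1 = 0) := by
    rintro ⟨h1, h2, h3⟩
    apply hne
    simp only [Prod.mk.injEq]
    omega
  replace e1 : (N : ℤ) ∣ ((z2 : ℤ) - z1) - (u2 - u1) := by convert e1 using 1; ring
  replace e2 : (c : ℤ) ∣ ((z2 : ℤ) - z1) - s * (w2 - w1) := by convert e2 using 1; ring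
  push_cast at bz
  generalize (z2 : ℤ) - z1 = z at *
  generalize (u2 : ℤ) - u1 = u at *
  generalize (w2 : ℤ) - w1 = w at *
  have hNz : (0 : ℤ) < N := by exact_mod_cast hN
  have hcz : (0 : ℤ) < c := by exact_mod_cast hc
  have hsq' : ∀ t : ℤ, t ^ 2 ≠ c := by
    intro t ht
    apply hsq
    refine ⟨t.natAbs, ?_⟩
    zify
    rw [← ht, ← sq, sq_abs]
  have d1 : (N : ℤ) ∣ z ^ 2 + c * u ^ 2 - N * w ^ 2 := by
    have : z ^ 2 + c * u ^ 2 - N * w ^ 2 = (z - u) * (z + u) + (c + 1) * u ^ 2 - N * w ^ 2 := by ring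
    rw [this]
    exact dvd_sub (dvd_add (e1.mul_right _) (h1.mul_right _)) (dvd_mul_right _ _)
  have d2 : (c : ℤ) ∣ z ^ 2 + c * u ^ 2 - N * w ^ 2 := by
    have : z ^ 2 + c * u ^ 2 - N * w ^ 2 = (z - s * w) * (z + s * w) + c * u ^ 2 + (s ^ 2 - N) * w ^ 2 := by ring
    rw [this]
    exact dvd_add (dvd_add (e2.mul_right _) (dvd_mul_right _ _)) (h2.mul_right _)
  have cop : IsCoprime (N : ℤ) c := by
    obtain ⟨k, hk⟩ := h1
    exact ⟨k, -1, by linarith⟩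
  obtain ⟨k, hk⟩ := cop.mul_dvd d1 d2
  have bw' : w ^ 2 < c := lt_of_le_of_ne bw (hsq' w)
  have hP : (0 : ℤ) < N * c := by positivity
  have k1 : -1 < k := by
    have : (N * c : ℤ) * (-1) < N * c * k := by
      rw [← hk]; nlinarith [sq_nonneg z, sq_nonneg u]
    exact lt_of_mul_lt_mul_left this hP.le
  have k2 : k < 2 := by
    have le : (N * c : ℤ) * k ≤ N * c * 2 := by
      rw [← hk]; nlinarith [sq_nonneg w]
    have := le_of_mul_le_mul_left le hP
    refine lt_of_le_of_ne this ?_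
    rintro rfl
    have hw : 0 ≤ (N : ℤ) * w ^ 2 := by positivity
    have q1 : (c : ℤ) * u ^ 2 ≤ c * N := mul_le_mul_of_nonneg_left bu hcz.le
    have hz : z ^ 2 = N * c := by linarith
    have hu : (c : ℤ) * u ^ 2 = c * N := by linarith
    have hu' : u ^ 2 = N := mul_left_cancel₀ hcz.ne' hu
    rw [← hu'] at hz
    have hu0 : u ≠ 0 := by rintro rfl; simp at hu'; omega
    have : u ∣ z := (Int.pow_dvd_pow_iff two_ne_zero).mp ⟨c, hz⟩
    obtain ⟨t, rfl⟩ := this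
    apply hsq' t
    have : u ^ 2 ≠ 0 := pow_ne_zero _ hu0
    apply mul_left_cancel₀ this
    linarith
  have : k = 0 ∨ k = 1 := by omega
  rcases this with rfl | rfl
  · refine ⟨w, z, u, ?_, by linarith⟩
    rintro rfl
    apply hne'
    have : z ^ 2 + c * u ^ 2 = 0 := by linarith
    have hz : 0 ≤ z ^ 2 := sq_nonneg z
    have hu : 0 ≤ c * u ^ 2 := by positivity
    have hz0 : z ^ 2 = 0 := by linarith
    have hu0 : c * u ^ 2 = 0 := by linarith
    simp only [mul_eq_zero, hcz.ne', false_or, pow_eq_zero_iff two_ne_zero] at hz0 hu0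
    exact ⟨hz0, hu0, rfl⟩
  · refine ⟨w ^ 2 + c, z * w + c * u, u * w - z, by positivity, ?_⟩
    have : (N : ℤ) * (w ^ 2 + c) = z ^ 2 + c * u ^ 2 := by linarith
    calc (N : ℤ) * (w ^ 2 + c) ^ 2 = (N * (w ^ 2 + c)) * (w ^ 2 + c) := by ring
      _ = _ := by rw [this]; ring

lemma neg_dir (n : ℕ) (m k : ℕ) (hn : n = 4 ^ m * (16 * k + 6)) 
    (h : ∃ x y z : ℚ, x ^ 2 + y ^ 2 + 10 * z ^ 2 = (n : ℚ)) : False := by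
  have key : ∀ W : ℕ, 0 < W → ∀ X Y Z : ℤ, X ^ 2 + Y ^ 2 + 10 * Z ^ 2 ≠ (W : ℤ) ^ 2 * (16 * k + 6) := by
    intro W
    induction W using Nat.strong_induction_on with
    | _ W ih =>
    intro hW X Y Z h
    have par : ∀ a : ℤ, (∃ b, a = 2 * b) ∨ (∃ b, a ^ 2 = 8 * b + 1) := by
      intro a
      rcases Int.even_or_odd' a with ⟨b, rfl | rfl⟩
      · exact Or.inl ⟨b, rfl⟩
      · right
        obtain ⟨c, hc⟩ := Int.even_mul_succ_self b
        exact ⟨c, by linarith [show (2 * b + 1) ^ 2 = 4 * (b * (b + 1)) + 1 by ring]⟩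
    have par4 : ∀ b : ℤ, (2 * b) ^ 2 = 4 * b ^ 2 := fun b => by ring
    have sq4 : ∀ b : ℤ, (∃ e, b ^ 2 = 4 * e) ∨ (∃ e, b ^ 2 = 8 * e + 1) := by
      intro b
      rcases par b with ⟨b, rfl⟩ | h
      · exact Or.inl ⟨b ^ 2, by ring⟩
      · exact Or.inr h
    rcases par W with ⟨w, hw⟩ | ⟨w, hw⟩
    · have h8 : (W : ℤ) ^ 2 * (16 * k + 6) = 8 * (w ^ 2 * (8 * k + 3)) := by rw [hw]; ring
      have h8' := h.trans h8
      rcases par X with ⟨x, rfl⟩ | ⟨x, hx⟩ <;> rcases par Y with ⟨y, rfl⟩ | ⟨y, hy⟩ <;>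
        rcases par Z with ⟨z, rfl⟩ | ⟨z, hz⟩ <;> (try simp only [par4] at h8') <;> try omega
      obtain ⟨v, rfl⟩ : ∃ v : ℕ, w = v := ⟨w.toNat, by omega⟩
      refine ih v (by omega) (by omega) x y z ?_
      linarith
    · have h8 : (W : ℤ) ^ 2 * (16 * k + 6) = 16 * (w * (8 * k + 3) + k) + 6 := by rw [hw]; ring
      have h8' := h.trans h8
      generalize w * (8 * (k:ℤ) + 3) + k = r at h8'
      rcases par X with ⟨x, rfl⟩ | ⟨x, hx⟩ <;> rcases par Y with ⟨y, rfl⟩ | ⟨y, hy⟩ <;>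
        rcases par Z with ⟨z, rfl⟩ | ⟨z, hz⟩ <;> (try simp only [par4] at h8') <;> try omega
      · rcases sq4 x with ⟨a, ha⟩ | ⟨a, ha⟩ <;> rcases sq4 y with ⟨b, hb⟩ | ⟨b, hb⟩ <;> omega
  obtain ⟨x, y, z, h⟩ := h
  have hW : 0 < x.den * y.den * z.den * 2 ^ m := by
    have := x.pos; have := y.pos; have := z.pos; positivity
  apply key (x.den * y.den * z.den * 2 ^ m) hW (x.num * y.den * z.den) (y.num * x.den * z.den)
    (z.num * x.den * y.den)
  have hx := Rat.num_div_den x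
  have hy := Rat.num_div_den y
  have hz := Rat.num_div_den z
  have hx0 : (x.den : ℚ) ≠ 0 := by exact_mod_cast x.den_nz
  have hy0 : (y.den : ℚ) ≠ 0 := by exact_mod_cast y.den_nz
  have hz0 : (z.den : ℚ) ≠ 0 := by exact_mod_cast z.den_nz
  rw [div_eq_iff hx0] at hx
  rw [div_eq_iff hy0] at hy
  rw [div_eq_iff hz0] at hz
  have h4 : ((2 : ℚ) ^ m) ^ 2 = 4 ^ m := by rw [← pow_mul, mul_comm, pow_mul]; norm_num
  have : ((x.num * y.den * z.den : ℚ)) ^ 2 + (y.num * x.den * z.den) ^ 2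
      + 10 * (z.num * x.den * y.den) ^ 2
      = (x.den * y.den * z.den * 2 ^ m) ^ 2 * (16 * k + 6) := by
    rw [hx, hy, hz, mul_pow _ ((2 : ℚ) ^ m), h4]
    subst hn
    push_cast at h
    linear_combination ((x.den : ℚ) * y.den * z.den) ^ 2 * h
  exact_mod_cast this

lemma sq_of_jac (N q : ℕ) [Fact q.Prime] (h : jacobiSym N q = 1) :
    ∃ s : ℤ, (q : ℤ) ∣ s ^ 2 - N := by
  obtain ⟨t, ht⟩ := ZMod.isSquare_of_jacobiSym_eq_one h
  refine ⟨t.val, ?_⟩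
  rw [← ZMod.intCast_zmod_eq_zero_iff_dvd]
  push_cast at ht ⊢
  rw [ZMod.natCast_zmod_val, ht]; ring

lemma nsq_two (q : ℕ) (hq : q.Prime) (h2 : q ≠ 2) : ¬ IsSquare (2 * q) := by
  rintro ⟨t, ht⟩
  have : 2 ∣ t := by
    have : 2 ∣ t * t := ⟨q, ht.symm⟩
    rcases (Nat.Prime.dvd_mul Nat.prime_two).1 this with h | h <;> exact h
  obtain ⟨r, rfl⟩ := this
  have : 2 ∣ q := ⟨r * r, by linarith⟩
  exact h2 ((Nat.prime_dvd_prime_iff_eq Nat.prime_two hq).1 this).symm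

lemma dir (N a : ℕ) (hN : 0 < N) (h : a.Coprime (4 * N)) :
    ∃ q : ℕ, q.Prime ∧ (q : ℤ) % 4 = (a : ℤ) % 4 ∧ (N : ℤ) ∣ q - a ∧ (N % 2 = 0 → q % 8 = a % 8) := by
  obtain ⟨q, -, hq, hm⟩ := Nat.forall_exists_prime_gt_and_modEq 0 (by omega) h
  have hm' : (4 * N : ℤ) ∣ a - q := by exact_mod_cast hm.dvd
  refine ⟨q, hq, ?_, ?_, ?_⟩
  · have : (4 : ℤ) ∣ a - q := (dvd_mul_right _ _).trans hm'
    omega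
  · rw [dvd_sub_comm]; exact (dvd_mul_left _ _).trans hm'
  · intro h2
    have : (8 : ℤ) ∣ a - q := by
      refine dvd_trans ?_ hm'
      obtain ⟨M, rfl⟩ : 2 ∣ N := Nat.dvd_of_mod_eq_zero h2
      exact ⟨M, by push_cast; ring⟩
    omega

lemma three_pre (N : ℕ) (h4 : N % 4 ≠ 0) (h7 : N % 8 ≠ 7) :
    ∃ c : ℕ, 0 < c ∧ ¬ IsSquare c ∧ (∃ s : ℤ, (c : ℤ) ∣ s ^ 2 - N) ∧ (N : ℤ) ∣ c + 1 ∧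
      ∃ a b : ℕ, c = a ^ 2 + b ^ 2 := by
  have hN : 0 < N := by omega
  have cop4 : ∀ a : ℕ, a % 2 = 1 → IsCoprime (a : ℤ) N → a.Coprime (4 * N) := by
    intro a h1 h2
    refine Nat.Coprime.mul_right ?_ (Nat.isCoprime_iff_coprime.1 h2)
    exact Nat.Coprime.pow_right 2 (Nat.coprime_two_right.2 (Nat.odd_iff.2 h1))
  have main1 : ∀ q : ℕ, q.Prime → q % 4 = 1 → (N : ℤ) ∣ q + 1 → jacobiSym N q = 1 → ∃ c : ℕ, 0 < c ∧ ¬ IsSquare c ∧ (∃ s : ℤ, (c : ℤ) ∣ s ^ 2 - N) ∧ (N : ℤ) ∣ c + 1 ∧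
      ∃ a b : ℕ, c = a ^ 2 + b ^ 2 := by
    intro q hq q1 hd hj
    have : Fact q.Prime := ⟨hq⟩
    obtain ⟨a, b, hab⟩ := Nat.Prime.sq_add_sq (p := q) (by omega)
    exact ⟨q, hq.pos, hq.prime.irreducible.not_isSquare, sq_of_jac N q hj, hd, a, b, hab.symm⟩
  have jm1 : ∀ (M : ℕ) (x : ℤ), (M : ℤ) ∣ x + 1 → jacobiSym x M = jacobiSym (-1) M := by
    intro M x h
    apply jacobiSym.mod_left'
    exact Int.emod_eq_emod_iff_emod_sub_eq_zero.2 (Int.emod_eq_zero_of_dvd (by simpa using h))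
  rcases (by omega : N % 4 = 1 ∨ N % 2 = 0 ∨ N % 8 = 3) with hc | hc | hc
  · obtain ⟨q, hq, q1, qd, -⟩ := dir N (2 * N - 1) hN (cop4 _ (by omega) (by
      rw [Nat.cast_sub (by omega)]; exact ⟨-1, 2, by push_cast; ring⟩))
    have q1' : q % 4 = 1 := by omega
    have qd' : (N : ℤ) ∣ q + 1 := by
      have := dvd_add qd (Dvd.intro_left (2:ℤ) rfl : (N:ℤ) ∣ 2 * N)
      refine (Eq.mp (congrArg _ ?_) this)
      omega
    apply main1 q hq q1' qd'
    rw [jacobiSym.quadratic_reciprocity_one_mod_four hc (Nat.odd_iff.2 (by omega)), jm1 _ _ qd',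
      jacobiSym.at_neg_one (Nat.odd_iff.2 (by omega)), ZMod.χ₄_nat_one_mod_four hc]
  · obtain ⟨q, hq, q1, qd, q8⟩ := dir N (N - 1) hN (cop4 _ (by omega) (by
      rw [Nat.cast_sub (by omega)]; exact ⟨-1, 1, by push_cast; ring⟩))
    have q1' : q % 4 = 1 := by omega
    have qd' : (N : ℤ) ∣ q + 1 := by
      have := dvd_add qd (dvd_refl (N : ℤ))
      refine (Eq.mp (congrArg _ ?_) this)
      omega
    apply main1 q hq q1' qd'
    have q8' := q8 hc
    obtain ⟨M, rfl⟩ : 2 ∣ N := Nat.dvd_of_mod_eq_zero hc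
    have hM : Odd M := Nat.odd_iff.2 (by omega)
    have hqo : Odd q := Nat.odd_iff.2 (by omega)
    have : (M : ℤ) ∣ q + 1 := dvd_trans ⟨2, by push_cast; ring⟩ qd'
    push_cast
    rw [jacobiSym.mul_left, jacobiSym.at_two hqo, jacobiSym.quadratic_reciprocity_one_mod_four' hM q1',
      jm1 _ _ this, jacobiSym.at_neg_one hM]
    rw [ZMod.χ₈_nat_mod_eight, ZMod.χ₄_nat_mod_four]
    rcases (by omega : (M % 4 = 1 ∧ q % 8 = 1) ∨ (M % 4 = 3 ∧ q % 8 = 5)) with ⟨h, h'⟩ | ⟨h, h'⟩ <;>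
      rw [h, h'] <;> decide
  · obtain ⟨q, hq, q1, qd, -⟩ := dir N ((N - 1) / 2) hN (cop4 _ (by omega) ⟨-2, 1, by omega⟩)
    have q0 : (N - 1) / 2 % 4 = 1 := by omega
    have q1' : q % 4 = 1 := by
      generalize (N - 1) / 2 = r at q0 q1
      omega
    have qd' : (N : ℤ) ∣ 2 * q + 1 := by
      have := dvd_add (qd.mul_left 2) (dvd_refl (N : ℤ))
      refine (Eq.mp (congrArg _ ?_) this)
      omega
    have : Fact q.Prime := ⟨hq⟩
    have hNo : Odd N := Nat.odd_iff.2 (by omega)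
    have hj : jacobiSym N q = 1 := by
      rw [jacobiSym.quadratic_reciprocity_one_mod_four' hNo q1']
      have e := jm1 N _ qd'
      rw [jacobiSym.mul_left, jacobiSym.at_neg_one hNo, jacobiSym.at_two hNo,
        ZMod.χ₈_nat_mod_eight, ZMod.χ₄_nat_three_mod_four (by omega), hc] at e
      have : ZMod.χ₈ ((3 : ℕ) : ZMod 8) = -1 := by decide
      rw [this] at e
      linarith
    obtain ⟨s, hs⟩ := sq_of_jac N q hj
    obtain ⟨a, b, hab⟩ := Nat.Prime.sq_add_sq (p := q) (by omega)
    refine ⟨2 * q, by omega, nsq_two q hq (by omega), ?_, by exact_mod_cast qd', ?_⟩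
    · have h2q : ∀ x : ℤ, (q : ℤ) ∣ x → 2 ∣ x → ((2 * q : ℕ) : ℤ) ∣ x := by
        intro x h1 h2
        push_cast
        exact IsCoprime.mul_dvd ⟨-((q : ℤ) / 2), 1, by omega⟩ h2 h1
      rcases Int.even_or_odd s with he | he
      · refine ⟨s + q, h2q _ ?_ ?_⟩
        · have : (s + q) ^ 2 - N = (s ^ 2 - N) + q * (2 * s + q) := by ring
          rw [this]; exact dvd_add hs (dvd_mul_right _ _)
        · have o1 : Odd (s + q) := he.add_odd (by exact_mod_cast Nat.odd_iff.2 (by omega))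
          have o2 : Odd (N : ℤ) := by exact_mod_cast hNo
          exact (o1.pow.sub_odd o2).two_dvd
      · refine ⟨s, h2q _ hs ?_⟩
        have o2 : Odd (N : ℤ) := by exact_mod_cast hNo
        exact (he.pow.sub_odd o2).two_dvd
    · refine ⟨a + b, Int.natAbs (a - b), ?_⟩
      zify
      rw [sq_abs, ← hab]; push_cast; ring

lemma three (N : ℕ) (h4 : N % 4 ≠ 0) (h7 : N % 8 ≠ 7) :
    ∃ x y z : ℚ, x ^ 2 + y ^ 2 + z ^ 2 = N := by
  obtain ⟨c, hc, hs, ⟨s, h2⟩, h1, a, b, hab⟩ := three_pre N h4 h7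
  obtain ⟨W, Z, U, hW, h⟩ := leg N c (by omega) hc hs s h1 h2
  have hW' : (W : ℚ) ≠ 0 := by exact_mod_cast hW
  have h' : (N : ℚ) * W ^ 2 = Z ^ 2 + c * U ^ 2 := by exact_mod_cast h
  refine ⟨Z / W, a * U / W, b * U / W, ?_⟩
  rw [hab] at h'
  push_cast at h'
  field_simp
  linarith

lemma three' (N : ℕ) (hN : 0 < N) (h : ¬ ∃ a j : ℕ, N = 4 ^ a * (8 * j + 7)) :
    ∃ x y z : ℚ, x ^ 2 + y ^ 2 + z ^ 2 = N := by
  induction N using Nat.strong_induction_on with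
  | _ N ih =>
  by_cases h4 : N % 4 = 0
  · obtain ⟨M, rfl⟩ := Nat.dvd_of_mod_eq_zero h4
    obtain ⟨x, y, z, e⟩ := ih M (by omega) (by omega) (by
      rintro ⟨a, j, rfl⟩
      exact h ⟨a + 1, j, by ring⟩)
    refine ⟨2 * x, 2 * y, 2 * z, ?_⟩
    push_cast
    linarith
  · apply three N h4
    intro h7
    exact h ⟨0, N / 8, by omega⟩

theorem stmt18 (n : ℕ) (hn : 0 < n) :
    (∃ x y z : ℚ, x ^ 2 + y ^ 2 + 10 * z ^ 2 = (n : ℚ)) ↔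
      ¬ ∃ m k : ℕ, n = 4 ^ m * (16 * k + 6) := by
  constructor
  · rintro h ⟨m, k, e⟩
    exact neg_dir n m k e h
  · intro h
    obtain ⟨x, y, z, e⟩ := three' (10 * n) (by omega) (by
      rintro ⟨a, j, e⟩
      rcases a with _ | a
      · omega
      have h5 : 5 ∣ 4 ^ (a + 1) * (8 * j + 7) := ⟨2 * n, by omega⟩
      have h5' : 5 ∣ 8 * j + 7 :=
        Nat.Coprime.dvd_of_dvd_mul_left (Nat.Coprime.pow_right _ (by norm_num)) h5
      obtain ⟨L, hL⟩ := h5'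
      refine h ⟨a, L / 8, ?_⟩
      have : 16 * (L / 8) + 6 = 2 * L := by omega
      rw [this]
      rw [hL, pow_succ] at e
      linarith)
    refine ⟨(3 * x + y) / 10, (x - 3 * y) / 10, z / 10, ?_⟩
    push_cast at e
    linarith
end
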